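/- arXiv:2312.00056 — 2 statements merged into one kernel-verified Lean document; each statement's English description precedes it below -/
import Mathlib

section
/- Closure of the constraint algebra for b-deformed bipartite maps with vertices of degree at most three: let q₁, q₂, q₃ ∈ K and, in the ring End_K(R)[t] of polynomials in a central variable t with operator coefficients, define for i ≥ 1 the operator L_i := −p_i^* + q₁·t·M⁽¹⁾_i + q₂·t²·M⁽²⁾_i + q₃·t³·M⁽³⁾_i, with the convention L_l = 0 for l ≤ 0. Then for all i, j ≥ 1: [L_i, L_j] = t · Σ_{l≥1} ( q₂·t·D̃_{ij,l}(2) + q₃·t²·D̃_{ij,l}(3) ) ∘ L_l (a locally finite sum). In particular the constraint operators of the trivalent bipartite map model are closed under commutation for every value of b. -/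
noncomputable section

/-- The polynomial ring `K[p₁, p₂, …]`, with one variable `p_i` for each positive integer. -/
abbrev Rp (K : Type) [Field K] : Type := MvPolynomial ℕ+ K

/-- The partial derivative `∂/∂p_i` as a `K`-linear endomorphism (junk value `0` for `i = 0`). -/
def pderivN (K : Type) [Field K] (i : ℕ) : Module.End K (Rp K) :=
  if h : 0 < i then (MvPolynomial.pderiv (⟨i, h⟩ : ℕ+)).toLinearMap else 0

/-- Multiplication by the variable `p_i` (junk value `0` for `i = 0`). -/
def mulpN (K : Type) [Field K] (i : ℕ) : Module.End K (Rp K) :=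
  if h : 0 < i then LinearMap.mulLeft K (MvPolynomial.X (⟨i, h⟩ : ℕ+)) else 0

/-- The operator `p_i^* = i·∂/∂p_i`. -/
def pstar (K : Type) [Field K] (i : ℕ) : Module.End K (Rp K) :=
  (i : K) • pderivN K i

/-- The currents with `J₀ = 0`: `J_{−k}` is multiplication by `p_k` and
`J_k = (1+b)·k·∂/∂p_k` for `k ≥ 1`. -/
def Jop (K : Type) [Field K] (b : K) (m : ℤ) : Module.End K (Rp K) :=
  if 0 < m then ((1 + b) * (m : K)) • pderivN K m.toNat else mulpN K (-m).toNat

/-- The currents of the bipartite-map model: as `Jop`, except that `J₀ = u·id`. -/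
def JopU (K : Type) [Field K] (b u : K) (m : ℤ) : Module.End K (Rp K) :=
  if m = 0 then u • (1 : Module.End K (Rp K)) else Jop K b m

/-- The structure operators `D̃_{ij,l}(m)` of the trivalent bipartite map model, `1 ≤ m ≤ 3`. -/
def Dtcoef (K : Type) [Field K] (b u : K) (i j l : ℕ) : ℕ → Module.End K (Rp K)
  | 2 => if (l : ℤ) = (i : ℤ) + (j : ℤ) - 2 then
      ((i : K) - (j : K)) • (1 : Module.End K (Rp K)) else 0
  | 3 =>
      (((i : K) - (j : K)) *
          (2 * (if (max i j : ℤ) - 1 ≤ (l : ℤ) then (1 : K) else 0) +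
            (if (max i j : ℤ) - 1 ≤ (l : ℤ) ∧ (l : ℤ) ≤ (i : ℤ) + (j : ℤ) - 3 then
              (1 : K) else 0)) +
        ((((i : ℤ) - (j : ℤ)).sign : K) *
            ((2 * (l : ℤ) - 3 * (min i j : ℤ) + 3 : ℤ) : K)) *
          (if (min i j : ℤ) - 1 ≤ (l : ℤ) ∧ (l : ℤ) ≤ (max i j : ℤ) - 2 then (1 : K) else 0)) •
        JopU K b u ((i : ℤ) + (j : ℤ) - 3 - (l : ℤ)) +
      (b * ((i : K) - (j : K)) * ((i : K) + (j : K) - 3)) •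
        (if (l : ℤ) = (i : ℤ) + (j : ℤ) - 3 then (1 : Module.End K (Rp K)) else 0)
  | _ => 0

/-- A linear operator on `R` acting coefficientwise on elements of `R[t]` (and `R[[t]]`),
the latter being encoded by their coefficient sequences `ℕ → R`. -/
def liftE (K : Type) [Field K] (φ : Module.End K (Rp K)) : Module.End K (ℕ → Rp K) where
  toFun := fun F n => φ (F n)
  map_add' := fun F G => by funext n; simp
  map_smul' := fun c F => by funext n; simp

/-- Multiplication by the central variable `t`, i.e. the coefficient shift. -/
def tshift (K : Type) [Field K] : Module.End K (ℕ → Rp K) where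
  toFun := fun F n => if n = 0 then 0 else F (n - 1)
  map_add' := fun F G => by funext n; by_cases h : n = 0 <;> simp [h]
  map_smul' := fun c F => by funext n; by_cases h : n = 0 <;> simp [h]

/-- The constraint operator `L_i = −p_i^* + q₁·t·M⁽¹⁾_i + q₂·t²·M⁽²⁾_i + q₃·t³·M⁽³⁾_i`
of the trivalent bipartite map model, an element of `End_K(R)[t]` realized faithfully by its
action on coefficient sequences, the central variable `t` acting as the shift `tshift`. -/
def Ltri (K : Type) [Field K] (q₁ q₂ q₃ : K) (Mv : ℕ → ℕ → Module.End K (Rp K)) (i : ℕ) :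
    Module.End K (ℕ → Rp K) :=
  liftE K (-pstar K i) + q₁ • (tshift K * liftE K (Mv 1 i)) +
    q₂ • (tshift K ^ 2 * liftE K (Mv 2 i)) + q₃ • (tshift K ^ 3 * liftE K (Mv 3 i))

section LocallyFiniteSums

/-- `FinHasSum f a`: the family `f` has finite support and its sum is `a`. -/
def FinHasSum {ι A : Type*} [AddCommGroup A] (f : ι → A) (a : A) : Prop :=
  (Function.support f).Finite ∧ ∑ᶠ n, f n = a

namespace FinHasSum

variable {ι κ A B : Type*} [AddCommGroup A] [AddCommGroup B] {f g : ι → A} {a c : A}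

theorem unique (hf : FinHasSum f a) (hg : FinHasSum f c) : a = c := hf.2.symm.trans hg.2

theorem of_finite (hf : (Function.support f).Finite) : FinHasSum f (∑ᶠ n, f n) := ⟨hf, rfl⟩

theorem add (hf : FinHasSum f a) (hg : FinHasSum g c) :
    FinHasSum (fun n => f n + g n) (a + c) :=
  ⟨(hf.1.union hg.1).subset (Function.support_add f g), by
    rw [finsum_add_distrib hf.1 hg.1, hf.2, hg.2]⟩

theorem map (φ : A →+ B) (hf : FinHasSum f a) : FinHasSum (fun n => φ (f n)) (φ a) :=
  ⟨hf.1.subset (Function.support_comp_subset (map_zero φ) f), by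
    rw [← hf.2, φ.map_finsum hf.1]⟩

theorem comp_equiv (e : κ ≃ ι) (hf : FinHasSum f a) : FinHasSum (fun n => f (e n)) a :=
  ⟨(hf.1.preimage e.injective.injOn), by rw [← hf.2]; exact finsum_comp_equiv e⟩

theorem single (n₀ : ι) (hf : ∀ n, n ≠ n₀ → f n = 0) : FinHasSum f (f n₀) :=
  ⟨(Set.finite_singleton n₀).subset fun n hn => by
      by_contra h
      exact hn (hf n h),
    finsum_eq_single f n₀ hf⟩

theorem fiberwise {F : ι × κ → A} (hF : FinHasSum F a)
    (h : ∀ n, FinHasSum (fun s => F (n, s)) (f n)) : FinHasSum f a := by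
  refine ⟨(hF.1.image Prod.fst).subset fun n hn => ?_, ?_⟩
  · by_contra hc
    refine hn ?_
    rw [← (h n).2]
    refine finsum_eq_zero_of_forall_eq_zero fun s => ?_
    by_contra hs
    exact hc ⟨(n, s), hs, rfl⟩
  · rw [← hF.2, finsum_curry F hF.1]
    exact finsum_congr fun n => (h n).2.symm

end FinHasSum

/-- `OpHasSum f X`: the family of operators `f` is locally finite with pointwise sum `X`. -/
def OpHasSum {ι K V : Type*} [Field K] [AddCommGroup V] [Module K V]
    (f : ι → Module.End K V) (X : Module.End K V) : Prop :=
  ∀ v, FinHasSum (fun n => f n v) (X v)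

namespace OpHasSum

variable {ι κ K V : Type*} [Field K] [AddCommGroup V] [Module K V]
  {f g : ι → Module.End K V} {X Y : Module.End K V}

theorem unique (hf : OpHasSum f X) (hg : OpHasSum f Y) : X = Y :=
  LinearMap.ext fun v => (hf v).unique (hg v)

theorem congr (hf : OpHasSum f X) (h : ∀ n, f n = g n) : OpHasSum g X := by
  rwa [← funext h]

theorem add (hf : OpHasSum f X) (hg : OpHasSum g Y) : OpHasSum (fun n => f n + g n) (X + Y) :=
  fun v => (hf v).add (hg v)

theorem mul_left (Y : Module.End K V) (hf : OpHasSum f X) :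
    OpHasSum (fun n => Y * f n) (Y * X) :=
  fun v => (hf v).map Y.toAddMonoidHom

theorem mul_right (Y : Module.End K V) (hf : OpHasSum f X) :
    OpHasSum (fun n => f n * Y) (X * Y) :=
  fun v => hf (Y v)

theorem smul (c : K) (hf : OpHasSum f X) : OpHasSum (fun n => c • f n) (c • X) :=
  fun v => (hf v).map (DistribSMul.toAddMonoidHom V c)

theorem neg (hf : OpHasSum f X) : OpHasSum (fun n => -f n) (-X) :=
  fun v => (hf v).map (-AddMonoidHom.id V)

theorem sub (hf : OpHasSum f X) (hg : OpHasSum g Y) : OpHasSum (fun n => f n - g n) (X - Y) := by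
  simpa only [sub_eq_add_neg] using hf.add hg.neg

theorem comp_equiv (e : κ ≃ ι) (hf : OpHasSum f X) : OpHasSum (fun n => f (e n)) X :=
  fun v => (hf v).comp_equiv e

theorem single (n₀ : ι) (hf : ∀ n, n ≠ n₀ → f n = 0) : OpHasSum f (f n₀) :=
  fun v => FinHasSum.single n₀ fun n hn => by rw [hf n hn, LinearMap.zero_apply]

theorem of_eq_zero (hf : ∀ n, f n = 0) : OpHasSum f 0 := fun v => by
  have h0 : (fun n => f n v) = fun _ => 0 := funext fun n => by rw [hf n, LinearMap.zero_apply]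
  rw [h0]
  exact ⟨by simp, by simp⟩

theorem fiberwise {F : ι × κ → Module.End K V} (hF : OpHasSum F X)
    (h : ∀ n, OpHasSum (fun s => F (n, s)) (f n)) : OpHasSum f X :=
  fun v => (hF v).fiberwise fun n => h n v

theorem exists_of_finite (h : ∀ v, (Function.support fun n => f n v).Finite) :
    ∃ X, OpHasSum f X := by
  refine ⟨{ toFun := fun v => ∑ᶠ n, f n v, map_add' := fun v w => ?_, map_smul' := fun c v => ?_ },
    fun v => ⟨h v, rfl⟩⟩
  · simp only [map_add]
    exact finsum_add_distrib (h v) (h w)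
  · simp only [map_smul, RingHom.id_apply]
    exact (smul_finsum' c (h v)).symm

end OpHasSum

end LocallyFiniteSums

section Coefficients

/-- The coefficient of `J_{i+j-3-l}` in the cubic structure operator, for `i > j`. -/
def structCoef (i j l : ℤ) : ℤ :=
  (if i - 1 ≤ l then 2 * (i - j) else 0) +
    (if i - 1 ≤ l ∧ l ≤ i + j - 3 then i - j else 0) +
    (if j - 1 ≤ l ∧ l ≤ i - 2 then 2 * l - 3 * j + 3 else 0)

/-- The coefficient of `J_{i+j-3-s} M_s` in `[M⁽²⁾_i, M⁽ᵐ⁺¹⁾_j]`, where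
`[M⁽²⁾_i, M⁽ᵐ⁾_n] = χ n • M⁽ᵐ⁾_{i+n-2}`. -/
def quadCoef (χ : ℤ → ℤ) (i j s : ℤ) : ℤ :=
  (if s ≤ i + j - 3 then s + 1 - j else 0) + (if j ≤ s then s + 1 - j else 0) +
    (if i - 1 ≤ s then χ (s - i + 2) else 0)

/-- The coefficient of `J_a J_{j+k-3-a}` in `[J_k, M⁽³⁾_j]`. -/
def currentCoef (k j a : ℤ) : ℤ :=
  (if 0 ≤ j + k - 3 - a ∧ 2 ≤ j + k then k else 0) +
    (if a ≤ j - 2 ∧ 0 ≤ j + k - 3 - a then k else 0) + (if a ≤ j - 2 ∧ k < 0 then k else 0)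

/-- The coefficient of `J_{j+k-3}` in `[J_k, M⁽³⁾_j]`, up to the factor `b`. -/
def currentLin (k j : ℤ) : ℤ :=
  (if 2 ≤ j + k then k * (j + k - 2) else 0) + (if k < 0 then k * (1 - k) else 0) +
    (if 3 ≤ j + k then (j - 1) * k else 0) + (if k < 0 then (j - 1) * k else 0)

/-- The reordering weight of `M⁽²⁾_{i+j-2-s} M⁽²⁾_s`. -/
def swapCoef (i j s : ℤ) : ℤ :=
  (if 1 ≤ s ∧ s ≤ j - 1 then j - 1 - s else 0) -
    (if i - 1 ≤ s ∧ s ≤ i + j - 3 then s - i + 1 else 0)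

/-- The coefficient of `J_a J_{i+j-4-s-a} M⁽²⁾_s` in the difference of the two sides of the
relation for `[M⁽³⁾_i, M⁽³⁾_j]`. -/
def quarticCoef (i j s a : ℤ) : ℤ :=
  (currentCoef (i - s - 1) j a - (if 0 ≤ i + j - 4 - s - a then swapCoef i j s else 0)) +
    (if 1 ≤ i - 1 - a then quadCoef (fun n => i - 1 - a - n) (i - 1 - a) j s else 0) -
    (if 1 ≤ i + j - 3 - a then structCoef i j (i + j - 3 - a) else 0)

theorem swapCoef_reflect {i j : ℤ} (hj : 1 ≤ j) (hij : j < i) (s : ℤ) :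
    swapCoef i j s + swapCoef i j (i + j - 2 - s) = 0 := by
  unfold swapCoef; omega

theorem quarticCoef_reflect {i j s : ℤ} (hj : 1 ≤ j) (hij : j < i) (hs : 1 ≤ s) (a : ℤ) :
    quarticCoef i j s a + quarticCoef i j s (i + j - 4 - s - a) = 0 := by
  unfold quarticCoef currentCoef swapCoef quadCoef structCoef
  beta_reduce
  grind (splits := 60)

theorem currentCoef_reflect {i j ε : ℤ} (hj : 1 ≤ j) (hij : j < i) (hε : ε = 0 ∨ ε = -1) (a : ℤ) :
    (currentCoef (i + ε) j a - currentCoef (j + ε) i a -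
      if 1 ≤ i + j - 3 - a then structCoef i j (i + j - 3 - a) else 0) +
    (currentCoef (i + ε) j (i + j - 3 + ε - a) - currentCoef (j + ε) i (i + j - 3 + ε - a) -
      if 1 ≤ a - ε then structCoef i j (a - ε) else 0) = 0 := by
  unfold currentCoef structCoef
  rcases hε with rfl | rfl <;> grind (splits := 60)

theorem quadCoef_sub_quadCoef {i j s : ℤ} (hj : 1 ≤ j) (hij : j < i) (hs : 1 ≤ s) :
    quadCoef (fun n => i - n) i j s - quadCoef (fun n => j - n) j i s =
      i - j + structCoef i j s := by
  unfold quadCoef structCoef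
  beta_reduce
  grind (splits := 60)

theorem quarticCoef_diag {i j : ℤ} (hj : 1 ≤ j) (hij : j < i) (hT : 1 ≤ i + j - 4) {a : ℤ} :
    quarticCoef i j (i + j - 4) a =
      (if a < 0 ∧ 2 - j ≤ a then i - j - 2 * a else 0) -
        (if 0 < a ∧ a ≤ j - 2 then i - j + 2 * a else 0) := by
  unfold quarticCoef currentCoef swapCoef quadCoef structCoef
  beta_reduce
  grind (splits := 60)

theorem quadCoef_reflect {i j s : ℤ} (hj : 1 ≤ j) (hi : 1 ≤ i) :
    (if 1 ≤ s then quadCoef (fun n => 1 - n) i j s - (i - j) else 0) +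
      (if 1 ≤ i + j - 2 - s then quadCoef (fun n => 1 - n) i j (i + j - 2 - s) - (i - j) else 0)
      = 0 := by
  unfold quadCoef
  beta_reduce
  grind (splits := 60)

theorem cubicLin_eq {i j s : ℤ} (hj : 1 ≤ j) (hij : j < i) (hs : 1 ≤ s) :
    currentLin (i - s - 1) j +
      (if 1 ≤ s + 3 - j then (s + 3 - j - 1) * (s + 3 - j - 2) +
        (j - 1) * (s + 3 - j - (j - 1)) else 0) -
      structCoef i j (s + 1) * s - swapCoef i j s * (i + j - 3 - s) =
    (i - j) * (i + j - 3) - (i - 1) * quadCoef (fun n => i - 1 - n) (i - 1) j s := by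
  unfold currentLin structCoef swapCoef quadCoef
  beta_reduce
  repeat' (split <;> try (exfalso; omega))
  all_goals first
    | ring1
    | (have h : s = i - 1 := by omega); subst h; ring1
    | (have h : s = i - 2 := by omega); subst h; ring1
    | (have h : s = j - 1 ∧ i = j + 1 := by omega); obtain ⟨rfl, rfl⟩ := h; ring1
    | (have h : s = j - 1 ∨ s = j - 2 := by omega); rcases h with rfl | rfl <;> ring1

theorem quadCoef_reflect_base {i j s : ℤ} (hj : 1 ≤ j) (hi : 1 ≤ i) (hij : i ≠ j)
    (h4 : i + j = 4) (hs : 1 ≤ s) : quadCoef (fun n => 1 - n) i j s = i - j := by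
  unfold quadCoef
  beta_reduce
  grind

theorem currentCoef_base {i j ε : ℤ} (hj : 1 ≤ j) (hij : j < i) (hε : ε = 0 ∨ ε = -1)
    (hT : i + j - 3 + ε = 0) (a : ℤ) :
    currentCoef (i + ε) j a - currentCoef (j + ε) i a -
      (if 1 ≤ i + j - 3 - a then structCoef i j (i + j - 3 - a) else 0) = 0 := by
  unfold currentCoef structCoef
  rcases hε with rfl | rfl
  · obtain rfl : j = 1 := by omega
    obtain rfl : i = 2 := by omega
    grind
  · obtain rfl : j = 1 := by omega
    obtain rfl : i = 3 := by omega
    grind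

theorem cubicScalar_eq (i j : ℤ) :
    (j - 1) * (j - 2) * (3 - j) + (i - 1) * ((i - 1 - 1) * (i - 1 - 2) +
      (j - 1) * (i - 1 - (j - 1))) - (i - j) * (i + j - 3) * (i + j - 4) = 0 := by
  ring

theorem quarticCoef_of_lt {i j s a : ℤ} (hj : 1 ≤ j) (hij : j < i) (hs : 1 ≤ s)
    (ha : i + j - 3 < a) : quarticCoef i j s a = 0 := by
  unfold quarticCoef currentCoef
  grind

theorem currentCoef_of_lt {k j a : ℤ} (h : j - 2 < a) (h' : j + k - 3 < a) :
    currentCoef k j a = 0 := by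
  unfold currentCoef
  grind

theorem swapCoef_support (i j : ℤ) : (Function.support (swapCoef i j)).Finite := by
  refine (Set.finite_Icc (min 1 (i - 1)) (max (j - 1) (i + j - 3))).subset fun s hs => ?_
  rw [Function.mem_support] at hs
  unfold swapCoef at hs
  simp only [Set.mem_Icc]
  grind

theorem swapCoef_ne_zero {i j s : ℤ} (hj : 1 ≤ j) (hij : j < i) (h : swapCoef i j s ≠ 0) :
    1 ≤ s ∧ s ≤ i + j - 3 := by
  unfold swapCoef at h
  grind

/-- The scalar contributions of the quartic terms and of the reordering of `M⁽²⁾ M⁽²⁾`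
cancel. -/
theorem finsum_quarticCoef_add_finsum_swapCoef {i j : ℤ} (hj : 1 ≤ j) (hij : j < i)
    (hT : 1 ≤ i + j - 4) :
    (∑ᶠ a, a * quarticCoef i j (i + j - 4) a) +
      ∑ᶠ s, swapCoef i j s * (i + j - 2 - 2 * s) = 0 := by
  set r₁ : ℤ → ℤ := fun s => if 1 ≤ s ∧ s ≤ j - 1 then (j - 1 - s) * (i + j - 2 - 2 * s) else 0
    with hr₁
  set r₂ : ℤ → ℤ := fun s =>
    if i - 1 ≤ s ∧ s ≤ i + j - 3 then -((s - i + 1) * (i + j - 2 - 2 * s)) else 0 with hr₂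
  have h₁ : FinHasSum r₁ (∑ᶠ s, r₁ s) :=
    .of_finite <| (Set.finite_Icc 1 (j - 1)).subset fun s hs => by
      by_contra h
      exact hs (if_neg h)
  have h₂ : FinHasSum r₂ (∑ᶠ s, r₂ s) :=
    .of_finite <| (Set.finite_Icc (i - 1) (i + j - 3)).subset fun s hs => by
      by_contra h
      exact hs (if_neg h)
  have h₃ : (fun s => swapCoef i j s * (i + j - 2 - 2 * s)) = fun s => r₁ s + r₂ s := by
    funext s
    simp only [hr₁, hr₂, swapCoef]
    split_ifs <;> ring
  have h₄ : FinHasSum (fun a => a * quarticCoef i j (i + j - 4) a)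
      (-(∑ᶠ s, r₁ s + ∑ᶠ s, r₂ s)) := by
    have h := ((h₁.comp_equiv (Equiv.subLeft (j - 1))).add
      (h₂.comp_equiv (Equiv.subLeft (i - 1)))).map (-AddMonoidHom.id ℤ)
    convert h using 1
    · funext a
      rw [quarticCoef_diag hj hij hT]
      simp only [hr₁, hr₂, Equiv.subLeft_apply, AddMonoidHom.neg_apply, AddMonoidHom.id_apply]
      rcases eq_or_ne a 0 with rfl | ha <;> split_ifs <;> first | ring1 | (exfalso; omega)
    · rfl
  rw [h₃, (h₁.add h₂).2, h₄.2]
  ring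
theorem currentLin_sub {i j ε : ℤ} (hj : 1 ≤ j) (hij : j < i) (hε : ε = 0 ∨ ε = -1) :
    currentLin (i + ε) j - currentLin (j + ε) i = (i - j) * (i + j - 3) := by
  unfold currentLin
  rcases hε with rfl | rfl
  · rw [if_pos (by omega), if_neg (by omega), if_pos (by omega), if_neg (by omega),
      if_pos (by omega), if_neg (by omega), if_pos (by omega), if_neg (by omega)]
    ring
  · by_cases h : i = 2
    · obtain rfl : j = 1 := by omega
      subst h
      norm_num
    · rw [if_pos (by omega), if_neg (by omega), if_pos (by omega), if_neg (by omega),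
        if_pos (by omega), if_neg (by omega), if_pos (by omega), if_neg (by omega)]
      ring

end Coefficients

section Towers

open Filter

/-- A Heisenberg family of currents `J` with central term `α`, together with the operators
`M m i` obtained from the currents by the recursion with parameter `b`. -/
structure IsCurrentTower {K V : Type*} [Field K] [AddCommGroup V] [Module K V] (α b : K)
    (J : ℤ → Module.End K V) (M : ℕ → ℤ → Module.End K V) : Prop where
  ne_zero : α ≠ 0
  comm : ∀ m n, ⁅J m, J n⁆ = (if m + n = 0 then α * m else 0) • (1 : Module.End K V)
  eventually_eq_zero : ∀ v, ∀ᶠ k in atTop, J k v = 0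
  of_nonpos : ∀ m i, i ≤ 0 → M m i = 0
  base : ∀ i, 1 ≤ i → α • M 1 i = J (i - 1)
  step : ∀ m, 1 ≤ m → ∀ i : ℤ, 1 ≤ i →
    OpHasSum (fun n => J (i - n - 1) * M m n) (M (m + 1) i - (b * (i - 1)) • M m (i - 1))

theorem commutator_zero {A : Type*} [Ring A] (X : A) : ⁅X, (0 : A)⁆ = 0 := by
  rw [Ring.lie_def, mul_zero, zero_mul, sub_zero]

theorem commutator_swap {A : Type*} [Ring A] (X Y : A) : ⁅X, Y⁆ = -⁅Y, X⁆ := by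
  rw [Ring.lie_def, Ring.lie_def, neg_sub]

theorem commutator_smul {K A : Type*} [CommRing K] [Ring A] [Algebra K A] (c : K) (X Y : A) :
    ⁅X, c • Y⁆ = c • ⁅X, Y⁆ := by
  rw [Ring.lie_def, Ring.lie_def, mul_smul_comm, smul_mul_assoc, smul_sub]

theorem smul_commutator {K A : Type*} [CommRing K] [Ring A] [Algebra K A] (c : K) (X Y : A) :
    ⁅c • X, Y⁆ = c • ⁅X, Y⁆ := by
  rw [Ring.lie_def, Ring.lie_def, mul_smul_comm, smul_mul_assoc, smul_sub]

theorem OpHasSum.single_of_eq {ι K V : Type*} [Field K] [AddCommGroup V] [Module K V]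
    {f : ι → Module.End K V} {X : Module.End K V} (n₀ : ι) (hf : ∀ n, n ≠ n₀ → f n = 0)
    (h : f n₀ = X) : OpHasSum f X :=
  h ▸ OpHasSum.single n₀ hf

theorem finite_support_of_eventually {A : Type*} [AddCommGroup A] {f : ℤ → A} (c : ℤ)
    (h₀ : ∀ n, n ≤ c → f n = 0) (h : ∀ᶠ n in atTop, f n = 0) : (Function.support f).Finite := by
  obtain ⟨B, hB⟩ := eventually_atTop.1 h
  refine (Set.finite_Icc c B).subset fun n hn => ⟨?_, ?_⟩
  · by_contra hc
    exact hn (h₀ n (by omega))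
  · by_contra hc
    exact hn (hB n (by omega))

/-- A sum with antisymmetric integral weights of products of operators is half the sum of the
commutators. -/
theorem OpHasSum.of_antisymm {K V : Type*} [Field K] [CharZero K] [AddCommGroup V] [Module K V]
    {P : ℤ → Module.End K V} {Y : Module.End K V} {g : ℤ → ℤ} {T : ℤ}
    (hg : ∀ a, g a + g (T - a) = 0) (hfin : (Function.support g).Finite) (x : ℤ → K)
    (hx : ∀ a, g a ≠ 0 → ⁅P a, P (T - a)⁆ = x a • Y) :
    OpHasSum (fun a => (g a : K) • (P a * P (T - a))) (((∑ᶠ a, (g a : K) * x a) / 2) • Y) := by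
  have hsub : ∀ {B : Type _} [AddCommGroup B] (f : ℤ → B), (∀ a, g a = 0 → f a = 0) →
      (Function.support f).Finite := fun f hf =>
    hfin.subset fun a ha h => ha (hf a h)
  obtain ⟨X, hX⟩ := OpHasSum.exists_of_finite
    (f := fun a => (g a : K) • (P a * P (T - a))) fun v => hsub _ fun a ha => by simp [ha]
  have hsum := hX.add (hX.comp_equiv (Equiv.subLeft T))
  have hscal : OpHasSum (fun a => ((g a : K) * x a) • Y) ((∑ᶠ a, (g a : K) * x a) • Y) :=
    fun v => (FinHasSum.of_finite (f := fun a => (g a : K) * x a)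
      (hfin.subset fun a ha h => ha (by simp [h]))).map
        ((LinearMap.toSpanSingleton K V (Y v)).toAddMonoidHom)
  have hXX : X + X = (∑ᶠ a, (g a : K) * x a) • Y := by
    refine hsum.unique (hscal.congr fun a => ?_)
    have hga : (g (T - a) : K) = -(g a : K) := by
      rw [← Int.cast_neg]
      exact congrArg _ (by have := hg a; omega)
    simp only [Equiv.subLeft_apply, sub_sub_cancel, hga]
    by_cases h0 : g a = 0
    · simp [h0]
    · rw [mul_smul, ← hx a h0, Ring.lie_def, smul_sub, neg_smul, sub_eq_add_neg]
  have h2 : X = ((∑ᶠ a, (g a : K) * x a) / 2) • Y := by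
    rw [div_eq_inv_mul, mul_smul, ← hXX, ← two_smul K X, smul_smul,
      inv_mul_cancel₀ (two_ne_zero), one_smul]
  exact h2 ▸ hX

namespace IsCurrentTower

variable {K V : Type*} [Field K] [AddCommGroup V] [Module K V] {α b : K}
  {J : ℤ → Module.End K V} {M : ℕ → ℤ → Module.End K V}

theorem smul_cancel (H : IsCurrentTower α b J M) {X Y : Module.End K V}
    (h : α • X = α • Y) : X = Y :=
  smul_right_injective _ H.ne_zero h

theorem eventually_apply_eq_zero (H : IsCurrentTower α b J M) {m : ℕ} (hm : 1 ≤ m) (v : V) :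
    ∀ᶠ i in atTop, M m i v = 0 := by
  induction m, hm using Nat.le_induction generalizing v with
  | base =>
    obtain ⟨B, hB⟩ := eventually_atTop.1 (H.eventually_eq_zero v)
    filter_upwards [eventually_ge_atTop (B + 1), eventually_ge_atTop 1] with i hi h1
    have h := congrArg (fun X : Module.End K V => X v) (H.base i h1)
    simp only [LinearMap.smul_apply, hB (i - 1) (by omega)] at h
    exact (smul_eq_zero.1 h).resolve_left H.ne_zero
  | succ m hm ih =>
    obtain ⟨B, hB⟩ := eventually_atTop.1 (ih v)
    have hJ : ∀ᶠ k in atTop, ∀ n ∈ Finset.Icc 1 B, J k (M m n v) = 0 :=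
      (Filter.eventually_all_finset _).2 fun n _ => H.eventually_eq_zero _
    obtain ⟨C, hC⟩ := eventually_atTop.1 hJ
    filter_upwards [eventually_ge_atTop (B + 1), eventually_ge_atTop 1,
      eventually_ge_atTop (C + B + 1)] with i hi h1 h2
    have hs := H.step m hm i h1 v
    have h0 : FinHasSum (fun n => (J (i - n - 1) * M m n) v) 0 := by
      have : (fun n => (J (i - n - 1) * M m n) v) = fun _ => 0 := by
        funext n
        simp only [Module.End.mul_apply]
        by_cases hn : 1 ≤ n
        · by_cases hn' : n ≤ B
          · exact hC _ (by omega) n (Finset.mem_Icc.2 ⟨hn, hn'⟩)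
          · rw [hB n (by omega), map_zero]
        · rw [H.of_nonpos m n (by omega), LinearMap.zero_apply, map_zero]
      rw [this]
      exact ⟨by simp, by simp⟩
    have := hs.unique h0
    simpa [hB (i - 1) (by omega)] using this

theorem finite_support_mul (H : IsCurrentTower α b J M) {m : ℕ} (hm : 1 ≤ m)
    (Y : ℤ → Module.End K V) (v : V) :
    (Function.support fun n => (Y n * M m n) v).Finite := by
  refine finite_support_of_eventually 0 (fun n hn => ?_) ?_
  · simp [H.of_nonpos m n hn]
  · filter_upwards [H.eventually_apply_eq_zero hm v] with n hn
    simp [hn]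

theorem finite_support_quadratic (H : IsCurrentTower α b J M) {m : ℕ} (hm : 1 ≤ m)
    {G : ℤ → ℤ → ℤ} {T A : ℤ}
    (hG : ∀ s a, 1 ≤ s → A < a → G s a = 0) (v : V) :
    (Function.support fun x : ℤ × ℤ =>
      ((G x.1 x.2 : K) • (J x.2 * J (T - x.1 - x.2) * M m x.1)) v).Finite := by
  obtain ⟨B, hB⟩ := eventually_atTop.1 (H.eventually_apply_eq_zero hm v)
  have hJ : ∀ᶠ k in atTop, ∀ n ∈ Finset.Icc 1 B, J k (M m n v) = 0 :=
    (Filter.eventually_all_finset _).2 fun n _ => H.eventually_eq_zero _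
  obtain ⟨C, hC⟩ := eventually_atTop.1 hJ
  refine ((Set.finite_Icc 1 B).prod (Set.finite_Icc (T - B - C) A)).subset ?_
  rintro ⟨s, a⟩ hx
  rw [Function.mem_support] at hx
  by_contra hc
  apply hx
  simp only [LinearMap.smul_apply, Module.End.mul_apply]
  by_cases h1 : 1 ≤ s
  · by_cases h2 : s ≤ B
    · by_cases h3 : A < a
      · simp [hG s a h1 h3]
      · have h4 : a < T - B - C := by
          by_contra h5
          exact hc ⟨⟨h1, h2⟩, ⟨by omega, by omega⟩⟩
        rw [hC _ (by omega) s (Finset.mem_Icc.2 ⟨h1, h2⟩)]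
        simp
    · rw [hB s (by omega)]
      simp
  · rw [H.of_nonpos m s (by omega)]
    simp

theorem antisymm_sum [CharZero K] (H : IsCurrentTower α b J M) {g : ℤ → ℤ} {T A : ℤ}
    (hg : ∀ a, g a + g (T - a) = 0) (hA : ∀ a, A < a → g a = 0) :
    OpHasSum (fun a => (g a : K) • (J a * J (T - a)))
      ((if T = 0 then α * ((∑ᶠ a, a * g a : ℤ) : K) / 2 else 0) • (1 : Module.End K V)) := by
  have hfin : (Function.support g).Finite := by
    refine (Set.finite_Icc (T - A) A).subset fun a ha => ⟨?_, ?_⟩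
    · by_contra h
      exact ha (by have := hg a; have := hA (T - a) (by omega); omega)
    · by_contra h
      exact ha (hA a (by omega))
  have h := OpHasSum.of_antisymm (P := J) (Y := 1) hg hfin
    (fun a => if T = 0 then α * a else 0) fun a _ => by
      rw [H.comm]
      simp only [add_sub_cancel]
  convert h using 2
  split_ifs with hT
  · have hc : ((∑ᶠ a, a * g a : ℤ) : K) = ∑ᶠ a, ((a * g a : ℤ) : K) :=
      (Int.castAddHom K).map_finsum (hfin.subset fun a ha h => ha (by simp [h]))
    rw [hc, mul_finsum]
    congr 1
    exact finsum_congr fun a => by push_cast; ring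
  · simp

theorem comm_step (H : IsCurrentTower α b J M) (X : Module.End K V) {m : ℕ}
    (hm : 1 ≤ m) {i : ℤ} (hi : 1 ≤ i) :
    OpHasSum (fun n => ⁅X, J (i - n - 1)⁆ * M m n + J (i - n - 1) * ⁅X, M m n⁆)
      (⁅X, M (m + 1) i⁆ - (b * (i - 1)) • ⁅X, M m (i - 1)⁆) := by
  have h := ((H.step m hm i hi).mul_left X).sub ((H.step m hm i hi).mul_right X)
  convert h using 1
  · funext n
    simp only [Ring.lie_def]
    noncomm_ring
  · simp only [Ring.lie_def, mul_sub, sub_mul, smul_sub, mul_smul_comm, smul_mul_assoc]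
    abel

end IsCurrentTower

end Towers

namespace IsCurrentTower

variable {K V : Type*} [Field K] [AddCommGroup V] [Module K V] {α b : K}
  {J : ℤ → Module.End K V} {M : ℕ → ℤ → Module.End K V}

theorem lie_one (H : IsCurrentTower α b J M) (k : ℤ) {n : ℤ} (hn : 1 ≤ n) :
    ⁅J k, M 1 n⁆ = (if k + n = 1 then (k : K) else 0) • (1 : Module.End K V) := by
  refine H.smul_cancel ?_
  rw [← commutator_smul, H.base n hn, H.comm, smul_smul]
  congr 1
  by_cases h : k + n = 1
  · rw [if_pos (by omega), if_pos h]
  · rw [if_neg (by omega), if_neg h, mul_zero]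

theorem lie_two (H : IsCurrentTower α b J M) (k : ℤ) {i : ℤ} (hi : 1 ≤ i) :
    ⁅J k, M 2 i⁆ = (((if 2 ≤ i + k then k else 0) + (if k < 0 then k else 0) : ℤ) : K) •
      J (i + k - 2) + (b * ((if i + k = 2 ∧ k < 0 then (i - 1) * k else 0 : ℤ) : K)) •
        (1 : Module.End K V) := by
  have h := H.comm_step (J k) le_rfl hi
  have h1 : OpHasSum (fun n => ⁅J k, J (i - n - 1)⁆ * M 1 n)
      (((if 2 ≤ i + k then k else 0 : ℤ) : K) • J (i + k - 2)) := by
    refine OpHasSum.single_of_eq (i + k - 1) (fun n hn => ?_) ?_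
    · rw [H.comm, if_neg (by omega), zero_smul, zero_mul]
    · rw [H.comm, if_pos (by ring)]
      split_ifs with hk
      · rw [show i + k - 2 = (i + k - 1) - 1 by ring, ← H.base (i + k - 1) (by omega),
          smul_mul_assoc, one_mul, smul_smul, mul_comm]
      · rw [H.of_nonpos 1 (i + k - 1) (by omega)]
        simp
  have h2 : OpHasSum (fun n => J (i - n - 1) * ⁅J k, M 1 n⁆)
      (((if k < 0 then k else 0 : ℤ) : K) • J (i + k - 2)) := by
    refine OpHasSum.single_of_eq (1 - k) (fun n hn => ?_) ?_
    · by_cases h1 : 1 ≤ n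
      · rw [H.lie_one k h1, if_neg (by omega), zero_smul, mul_zero]
      · rw [H.of_nonpos 1 n (by omega), commutator_zero, mul_zero]
    · rw [show i - (1 - k) - 1 = i + k - 2 by ring]
      by_cases h1 : k < 0
      · rw [H.lie_one k (by omega), if_pos (by ring), if_pos h1, mul_smul_comm, mul_one]
      · rw [if_neg h1, Int.cast_zero, zero_smul]
        rcases (show 0 ≤ k by omega).eq_or_lt with rfl | h2
        · rw [H.lie_one 0 (by omega)]
          simp
        · rw [H.of_nonpos 1 (1 - k) (by omega), commutator_zero, mul_zero]
  have h3 : (b * (i - 1)) • ⁅J k, M 1 (i - 1)⁆ =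
      (b * ((if i + k = 2 ∧ k < 0 then (i - 1) * k else 0 : ℤ) : K)) • (1 : Module.End K V) := by
    rcases hi.eq_or_lt with rfl | h1
    · simp
    · rw [H.lie_one k (by omega), smul_smul, mul_assoc]
      congr 2
      by_cases h4 : i + k = 2
      · rw [if_pos (by omega)]
        by_cases h5 : k < 0
        · rw [if_pos ⟨h4, h5⟩]
          push_cast
          ring
        · have : k = 0 := by omega
          subst this
          simp
      · rw [if_neg (by omega), if_neg (by tauto)]
        simp
  have h4 := h.unique (h1.add h2)
  rw [h3, ← add_smul, ← Int.cast_add] at h4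
  exact sub_eq_iff_eq_add.1 h4

theorem base_sum (H : IsCurrentTower α b J M) {i : ℤ} (hi : 1 ≤ i) :
    OpHasSum (fun a => (if 0 ≤ i - 2 - a then J a * J (i - 2 - a) else 0))
      (α • M 2 i - (b * (i - 1)) • J (i - 2)) := by
  have h := ((H.step 1 le_rfl i hi).smul α).comp_equiv (Equiv.subLeft (i - 1))
  convert h using 1
  · funext a
    rw [← mul_smul_comm, Equiv.subLeft_apply, show i - (i - 1 - a) - 1 = a by ring]
    split_ifs with h1
    · rw [H.base _ (by omega), show i - 1 - a - 1 = i - 2 - a by ring]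
    · rw [H.of_nonpos 1 _ (by omega), smul_zero, mul_zero]
  · rw [smul_sub, smul_comm α]
    rcases hi.eq_or_lt with rfl | h1
    · simp
    · rw [H.base _ (by omega), show i - 1 - 1 = i - 2 by ring]

theorem lie_three (H : IsCurrentTower α b J M) (k : ℤ) {j : ℤ} (hj : 1 ≤ j) :
    OpHasSum (fun a => (currentCoef k j a : K) • (J a * J (j + k - 3 - a)))
      (⁅J k, M 3 j⁆ - (b * (currentLin k j : K)) • J (j + k - 3) -
        (b ^ 2 * ((if j + k = 3 ∧ k < 0 then (j - 1) * (j - 2) * k else 0 : ℤ) : K)) •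
          (1 : Module.End K V)) := by
  have h := H.comm_step (J k) (m := 2) (by norm_num) hj
  have h1 : OpHasSum (fun n => ⁅J k, J (j - n - 1)⁆ * M 2 n)
      ((k : K) • (α • M 2 (j + k - 1))) := by
    refine OpHasSum.single_of_eq (j + k - 1) (fun n hn => ?_) ?_
    · rw [H.comm, if_neg (by omega), zero_smul, zero_mul]
    · rw [H.comm, if_pos (by ring), smul_mul_assoc, one_mul, smul_smul, mul_comm]
  have h1' : OpHasSum (fun a => ((if 0 ≤ j + k - 3 - a ∧ 2 ≤ j + k then k else 0 : ℤ) : K) •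
      (J a * J (j + k - 3 - a))) ((k : K) • (α • M 2 (j + k - 1)) -
        (b * ((if 2 ≤ j + k then k * (j + k - 2) else 0 : ℤ) : K)) • J (j + k - 3)) := by
    by_cases hk : 2 ≤ j + k
    · convert (H.base_sum (i := j + k - 1) (by omega)).smul (k : K) using 1
      · funext a
        rw [show j + k - 1 - 2 - a = j + k - 3 - a by ring]
        by_cases ha : 0 ≤ j + k - 3 - a
        · rw [if_pos ⟨ha, hk⟩, if_pos ha]
        · rw [if_neg (by tauto), if_neg ha]
          simp
      · rw [smul_sub, smul_smul (k : K) (b * _), if_pos hk,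
          show j + k - 1 - 2 = j + k - 3 by ring]
        congr 2
        push_cast
        ring
    · rw [H.of_nonpos 2 (j + k - 1) (by omega), if_neg hk]
      simp only [smul_zero, Int.cast_zero, mul_zero, zero_smul, sub_zero]
      exact OpHasSum.of_eq_zero fun a => by rw [if_neg (by tauto)]; simp
  have h3 : OpHasSum (fun n => (b * ((if n + k = 2 ∧ k < 0 then (n - 1) * k else 0 : ℤ) : K)) •
      J (j - n - 1)) ((b * ((if k < 0 then k * (1 - k) else 0 : ℤ) : K)) • J (j + k - 3)) := by
    refine OpHasSum.single_of_eq (2 - k) (fun n hn => ?_) ?_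
    · rw [if_neg (by omega)]
      simp
    · rw [show j - (2 - k) - 1 = j + k - 3 by ring]
      congr 3
      split_ifs <;> first | omega | ring
  have h2 : OpHasSum (fun a => ((((if a ≤ j - 2 ∧ 0 ≤ j + k - 3 - a then k else 0) +
      (if a ≤ j - 2 ∧ k < 0 then k else 0) : ℤ)) : K) • (J a * J (j + k - 3 - a)))
        (⁅J k, M 3 j⁆ - (b * (j - 1)) • ⁅J k, M 2 (j - 1)⁆ - (k : K) • (α • M 2 (j + k - 1)) -
          (b * ((if k < 0 then k * (1 - k) else 0 : ℤ) : K)) • J (j + k - 3)) := by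
    refine ((h.sub h1).sub h3).comp_equiv (Equiv.subLeft (j - 1)) |>.congr fun a => ?_
    simp only [Equiv.subLeft_apply]
    rw [add_sub_cancel_left, show j - (j - 1 - a) - 1 = a by ring]
    by_cases ha : a ≤ j - 2
    · rw [H.lie_two k (show 1 ≤ j - 1 - a by omega), mul_add, mul_smul_comm, mul_smul_comm, mul_one,
        add_sub_cancel_right, show j - 1 - a + k - 2 = j + k - 3 - a by ring]
      congr 2
      split_ifs <;> omega
    · rw [H.of_nonpos 2 (j - 1 - a) (by omega), if_neg (by omega), if_neg (by omega),
        if_neg (by omega), commutator_zero]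
      simp
  have h4 : (b * (j - 1)) • ⁅J k, M 2 (j - 1)⁆ =
      (b * ((((if 3 ≤ j + k then (j - 1) * k else 0) +
          (if k < 0 then (j - 1) * k else 0) : ℤ)) : K)) •
        J (j + k - 3) +
        (b ^ 2 * ((if j + k = 3 ∧ k < 0 then (j - 1) * (j - 2) * k else 0 : ℤ) : K)) •
          (1 : Module.End K V) := by
    rcases hj.eq_or_lt with rfl | h5
    · simp
    · rw [H.lie_two k (show 1 ≤ j - 1 by omega), smul_add, smul_smul, smul_smul,
        show j - 1 + k - 2 = j + k - 3 by ring]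
      congr 2
      · rw [mul_assoc]
        congr 1
        rw [show (j : K) - 1 = ((j - 1 : ℤ) : K) by push_cast; ring, ← Int.cast_mul]
        congr 1
        rw [mul_add]
        congr 1 <;> split_ifs <;> omega
      · by_cases h6 : j + k = 3 ∧ k < 0
        · rw [if_pos h6, if_pos (by omega)]
          push_cast
          ring
        · rw [if_neg h6, if_neg (by omega)]
          simp
  convert h2.add h1' using 1
  · funext a
    rw [← add_smul, ← Int.cast_add]
    congr 2
    unfold currentCoef
    ring
  · rw [h4]
    unfold currentLin
    push_cast
    module

/-- If `M 2 i` acts on the operators `M m n` as on a family of weight `χ`, then its commutator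
with `M (m + 1) j` is the following sum. -/
theorem lie_succ (H : IsCurrentTower α b J M) {m : ℕ} (hm : 1 ≤ m) {i j : ℤ} (hi : 1 ≤ i)
    (hj : 1 ≤ j) (χ : ℤ → ℤ) (hχ : ∀ n, 1 ≤ n → ⁅M 2 i, M m n⁆ = (χ n : K) • M m (i + n - 2)) :
    OpHasSum (fun s => (quadCoef χ i j s : K) • (J (i + j - 3 - s) * M m s))
      (⁅M 2 i, M (m + 1) j⁆ - (b * (((i - 1) * (i - 2) + (j - 1) * χ (j - 1) : ℤ) : K)) •
        M m (i + j - 3)) := by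
  have h := H.comm_step (M 2 i) hm hj
  have hb : (b * (j - 1)) • ⁅M 2 i, M m (j - 1)⁆ =
      (b * (((j - 1) * χ (j - 1) : ℤ) : K)) • M m (i + j - 3) := by
    rcases hj.eq_or_lt with rfl | h1
    · simp
    · rw [hχ _ (by omega), smul_smul, show i + (j - 1) - 2 = i + j - 3 by ring]
      congr 1
      push_cast
      ring
  have h2 : OpHasSum (fun s => (b * ((if i + (j - s - 1) = 2 ∧ j - s - 1 < 0 then
      (i - 1) * (j - s - 1) else 0 : ℤ) : K)) • M m s)
        (-(b * (((i - 1) * (i - 2) : ℤ) : K)) • M m (i + j - 3)) := by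
    refine OpHasSum.single_of_eq (i + j - 3) (fun n hn => ?_) ?_
    · rw [if_neg (by omega)]
      simp
    · congr 1
      rw [← mul_neg, ← Int.cast_neg]
      congr 2
      by_cases h3 : 2 < i
      · rw [if_pos (by omega)]
        ring
      · have : i = 1 ∨ i = 2 := by omega
        rcases this with rfl | rfl
        · simp
        · rw [if_neg (by omega)]
          simp
  obtain ⟨X, hX⟩ := OpHasSum.exists_of_finite
    (f := fun n => J (j - n - 1) * ⁅M 2 i, M m n⁆) fun v => by
      refine finite_support_of_eventually 0 (fun n hn => ?_) ?_
      · rw [H.of_nonpos m n hn, commutator_zero]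
        simp
      · filter_upwards [H.eventually_apply_eq_zero hm v,
          (Filter.tendsto_atTop_add_const_left _ i Filter.tendsto_id).eventually
            (Filter.tendsto_atTop_add_const_right _ (-2) Filter.tendsto_id |>.eventually
              (H.eventually_apply_eq_zero hm v)),
          Filter.eventually_ge_atTop 1] with n _ hn h1
        simp only [id, ← sub_eq_add_neg] at hn
        rw [hχ n h1]
        simp [hn]
  have hX' := hX.comp_equiv (Equiv.addRight (2 - i))
  have h5 := ((h.sub hX).add h2).add hX'
  convert h5 using 1
  · funext s
    simp only [Equiv.coe_addRight, add_sub_cancel_right]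
    rw [commutator_swap (M 2 i), H.lie_two _ hi, show i + (j - s - 1) - 2 = i + j - 3 - s by ring,
      show j - (s + (2 - i)) - 1 = i + j - 3 - s by ring]
    by_cases h6 : 1 ≤ s
    · have h7 : J (i + j - 3 - s) * ⁅M 2 i, M m (s + (2 - i))⁆ =
          ((if i - 1 ≤ s then χ (s - i + 2) else 0 : ℤ) : K) • (J (i + j - 3 - s) * M m s) := by
        split_ifs with h8
        · rw [hχ _ (by omega), mul_smul_comm, show i + (s + (2 - i)) - 2 = s by ring,
            show s + (2 - i) = s - i + 2 by ring]
        · rw [H.of_nonpos m _ (by omega), commutator_zero]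
          simp
      have h8 : quadCoef χ i j s = -((if 2 ≤ i + (j - s - 1) then j - s - 1 else 0) +
          (if j - s - 1 < 0 then j - s - 1 else 0)) + (if i - 1 ≤ s then χ (s - i + 2) else 0) := by
        unfold quadCoef
        congr 1
        split_ifs <;> omega
      rw [h7, h8, neg_mul, add_mul, smul_mul_assoc, smul_mul_assoc, one_mul]
      push_cast
      module
    · rw [H.of_nonpos m s (by omega)]
      have h7 : J (i + j - 3 - s) * ⁅M 2 i, M m (s + (2 - i))⁆ = 0 := by
        by_cases h8 : i - 1 ≤ s
        · have : s = 0 := by omega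
          subst this
          rw [hχ _ (by omega), H.of_nonpos m _ (by omega), smul_zero, mul_zero]
        · rw [H.of_nonpos m _ (by omega), commutator_zero]
          simp
      rw [h7]
      simp
  · rw [hb]
    push_cast
    module

end IsCurrentTower

namespace IsCurrentTower

variable {K V : Type*} [Field K] [AddCommGroup V] [Module K V] {α b : K}
  {J : ℤ → Module.End K V} {M : ℕ → ℤ → Module.End K V}

theorem lie_two_one (H : IsCurrentTower α b J M) {i n : ℤ} (hi : 1 ≤ i) (hn : 1 ≤ n) :
    ⁅M 2 i, M 1 n⁆ = ((1 - n : ℤ) : K) • M 1 (i + n - 2) := by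
  refine H.smul_cancel ?_
  rw [← commutator_smul, H.base n hn, commutator_swap, H.lie_two _ hi,
    if_neg (show ¬ (n - 1 < 0) by omega),
    if_neg (show ¬ (i + (n - 1) = 2 ∧ n - 1 < 0) by omega),
    show i + (n - 1) - 2 = i + n - 3 by ring]
  simp only [add_zero, Int.cast_zero, mul_zero, zero_smul]
  by_cases h : 3 ≤ i + n
  · rw [if_pos (by omega), smul_comm, H.base _ (by omega), show i + n - 2 - 1 = i + n - 3 by ring]
    push_cast
    module
  · rw [if_neg (by omega), H.of_nonpos 1 _ (by omega)]
    simp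

theorem lie_two_two [CharZero K] (H : IsCurrentTower α b J M) {i j : ℤ} (hi : 1 ≤ i)
    (hj : 1 ≤ j) : ⁅M 2 i, M 2 j⁆ = ((i - j : ℤ) : K) • M 2 (i + j - 2) := by
  rcases eq_or_ne i j with rfl | hij
  · simp [Ring.lie_def]
  have h1 := H.lie_succ le_rfl hi hj (fun n => 1 - n) fun n hn => H.lie_two_one hi hn
  have h2 := H.step 1 le_rfl (i + j - 2) (by omega)
  have h3 := ((h1.sub (h2.smul ((i - j : ℤ) : K))).smul α).comp_equiv (Equiv.subLeft (i + j - 3))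
  have h4 := H.antisymm_sum (T := i + j - 4) (A := i + j - 4)
    (g := fun a => if 1 ≤ i + j - 3 - a then
      quadCoef (fun n => 1 - n) i j (i + j - 3 - a) - (i - j) else 0)
    (fun a => by
      have := quadCoef_reflect (s := i + j - 3 - a) hj hi
      rw [show i + j - 2 - (i + j - 3 - a) = i + j - 3 - (i + j - 4 - a) by ring] at this
      exact this)
    (fun a ha => if_neg (by omega))
  have h5 := h3.unique (h4.congr fun a => ?_)
  · rw [show (if i + j - 4 = 0 then α * ((∑ᶠ a, a * (if 1 ≤ i + j - 3 - a then
        quadCoef (fun n => 1 - n) i j (i + j - 3 - a) - (i - j) else 0) : ℤ) : K) / 2 else 0) = 0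
        from ?_, zero_smul, smul_eq_zero] at h5
    · have h6 := h5.resolve_left H.ne_zero
      rw [show i + j - 2 - 1 = i + j - 3 by ring] at h6
      rw [← sub_eq_zero, ← h6]
      push_cast
      module
    · split_ifs with hT
      · rw [finsum_eq_zero_of_forall_eq_zero fun a => ?_]
        · simp
        · split_ifs with ha
          · rw [quadCoef_reflect_base hj hi hij (by omega) ha]
            ring
          · ring
      · rfl
  · simp only [Equiv.subLeft_apply]
    rw [show i + j - 3 - (i + j - 3 - a) = a by ring,
      show i + j - 2 - (i + j - 3 - a) - 1 = a by ring]
    split_ifs with ha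
    · rw [show i + j - 4 - a = i + j - 3 - a - 1 by ring, ← H.base _ ha, mul_smul_comm,
        Int.cast_sub, sub_smul, smul_sub, smul_comm α, smul_comm α]
    · rw [H.of_nonpos 1 _ (by omega)]
      simp

theorem structCoef_sum_currents [CharZero K] (H : IsCurrentTower α b J M) {i j ε : ℤ}
    (hj : 1 ≤ j) (hij : j < i) (hε : ε = 0 ∨ ε = -1) :
    OpHasSum (fun l => ((if 1 ≤ l then structCoef i j l else 0 : ℤ) : K) •
        (J (i + j - 3 - l) * J (l + ε)))
      (⁅J (i + ε), M 3 j⁆ - ⁅J (j + ε), M 3 i⁆ -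
        (b * (((i - j) * (i + j - 3) : ℤ) : K)) • J (i + j - 3 + ε)) := by
  have h1 := H.lie_three (i + ε) hj
  have h2 := H.lie_three (j + ε) (j := i) (by omega)
  rw [if_neg (by omega)] at h1 h2
  have h3 := H.antisymm_sum (T := i + j - 3 + ε) (A := i + j - 3)
    (g := fun a => currentCoef (i + ε) j a - currentCoef (j + ε) i a -
      if 1 ≤ i + j - 3 - a then structCoef i j (i + j - 3 - a) else 0)
    (fun a => by
      have := currentCoef_reflect hj hij hε a
      rw [show a - ε = i + j - 3 - (i + j - 3 + ε - a) by ring] at this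
      exact this)
    (fun a ha => by
      rw [currentCoef_of_lt (by omega) (by omega), currentCoef_of_lt (by omega) (by omega),
        if_neg (by omega)]
      ring)
  have h4 : (if i + j - 3 + ε = 0 then α * ((∑ᶠ a, a * (currentCoef (i + ε) j a -
      currentCoef (j + ε) i a -
        if 1 ≤ i + j - 3 - a then structCoef i j (i + j - 3 - a) else 0) : ℤ) : K) / 2
          else 0) = 0 := by
    split_ifs with hT
    · rw [finsum_eq_zero_of_forall_eq_zero fun a => ?_]
      · simp
      · rw [currentCoef_base hj hij hε hT]
        ring
    · rfl
  rw [h4, zero_smul] at h3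
  convert ((h1.sub h2).sub h3).comp_equiv (Equiv.subLeft (i + j - 3)) using 1
  · funext l
    simp only [Equiv.subLeft_apply]
    rw [show j + (i + ε) - 3 - (i + j - 3 - l) = l + ε by ring,
      show i + (j + ε) - 3 - (i + j - 3 - l) = l + ε by ring,
      show i + j - 3 + ε - (i + j - 3 - l) = l + ε by ring,
      show i + j - 3 - (i + j - 3 - l) = l by ring, ← sub_smul, ← sub_smul, ← Int.cast_sub,
      ← Int.cast_sub]
    congr 2
    ring
  · rw [show j + (i + ε) - 3 = i + j - 3 + ε by ring,
      show i + (j + ε) - 3 = i + j - 3 + ε by ring, ← currentLin_sub hj hij hε]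
    push_cast
    module

theorem structCoef_sum_two [CharZero K] (H : IsCurrentTower α b J M) {i j : ℤ}
    (hj : 1 ≤ j) (hij : j < i) :
    OpHasSum (fun l => ((if 1 ≤ l then structCoef i j l else 0 : ℤ) : K) •
        (J (i + j - 3 - l) * M 2 l))
      (⁅M 2 i, M 3 j⁆ + ⁅M 3 i, M 2 j⁆ - ((i - j : ℤ) : K) • M 3 (i + j - 2) -
        (b * (((i - j) * (i + j - 3) : ℤ) : K)) • M 2 (i + j - 3)) := by
  have hi : 1 ≤ i := by omega
  have h1 := H.lie_succ (m := 2) (by norm_num) hi hj (fun n => i - n)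
    fun n hn => H.lie_two_two hi hn
  have h2 := H.lie_succ (m := 2) (by norm_num) hj hi (fun n => j - n)
    fun n hn => H.lie_two_two hj hn
  have h3 := H.step 2 (by norm_num) (i + j - 2) (by omega)
  convert (h1.sub h2).sub (h3.smul ((i - j : ℤ) : K)) using 1
  · funext l
    rw [show j + i - 3 - l = i + j - 3 - l by ring,
      show i + j - 2 - l - 1 = i + j - 3 - l by ring, ← sub_smul, ← sub_smul, ← Int.cast_sub,
      ← Int.cast_sub]
    by_cases hl : 1 ≤ l
    · rw [if_pos hl, quadCoef_sub_quadCoef hj hij hl]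
      congr 2
      ring
    · rw [H.of_nonpos 2 l (by omega), mul_zero, smul_zero, smul_zero]
  · rw [commutator_swap (M 3 i), show j + i - 3 = i + j - 3 by ring,
      show i + j - 2 - 1 = i + j - 3 by ring]
    push_cast
    module

end IsCurrentTower

namespace IsCurrentTower

variable {K V : Type*} [Field K] [AddCommGroup V] [Module K V] {α b : K}
  {J : ℤ → Module.End K V} {M : ℕ → ℤ → Module.End K V}

theorem swapCoef_sum [CharZero K] (H : IsCurrentTower α b J M) {i j : ℤ} (hj : 1 ≤ j)
    (hij : j < i) :
    OpHasSum (fun s => (swapCoef i j s : K) • (M 2 (i + j - 2 - s) * M 2 s))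
      ((((∑ᶠ s, swapCoef i j s * (i + j - 2 - 2 * s) : ℤ) : K) / 2) • M 2 (i + j - 4)) := by
  have h := OpHasSum.of_antisymm (P := fun n => M 2 (i + j - 2 - n)) (Y := M 2 (i + j - 4))
    (swapCoef_reflect hj hij) (swapCoef_support i j)
    (fun s => ((i + j - 2 - 2 * s : ℤ) : K)) fun s hs => by
      obtain ⟨h1, h2⟩ := swapCoef_ne_zero hj hij hs
      rw [H.lie_two_two (by omega) (by omega),
        show i + j - 2 - s - (i + j - 2 - (i + j - 2 - s)) = i + j - 2 - 2 * s by ring,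
        show i + j - 2 - s + (i + j - 2 - (i + j - 2 - s)) - 2 = i + j - 4 by ring]
  simp only [sub_sub_cancel] at h
  have hc : ((∑ᶠ s, swapCoef i j s * (i + j - 2 - 2 * s) : ℤ) : K) =
      ∑ᶠ s, ((swapCoef i j s * (i + j - 2 - 2 * s) : ℤ) : K) :=
    (Int.castAddHom K).map_finsum
      ((swapCoef_support i j).subset fun a ha h => ha (by simp [h]))
  rw [hc]
  simpa only [Int.cast_mul] using h

theorem quarticCoef_sum [CharZero K] (H : IsCurrentTower α b J M) {i j : ℤ} (hj : 1 ≤ j)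
    (hij : j < i) {X : Module.End K V}
    (hX : OpHasSum (fun x : ℤ × ℤ => (quarticCoef i j x.1 x.2 : K) •
      (J x.2 * J (i + j - 4 - x.1 - x.2) * M 2 x.1)) X) :
    X = (α * ((∑ᶠ a, a * quarticCoef i j (i + j - 4) a : ℤ) : K) / 2) • M 2 (i + j - 4) := by
  have h : ∀ s, OpHasSum (fun a => (quarticCoef i j s a : K) •
      (J a * J (i + j - 4 - s - a) * M 2 s))
      ((if i + j - 4 - s = 0 then α * ((∑ᶠ a, a * quarticCoef i j s a : ℤ) : K) / 2 else 0) •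
        M 2 s) := fun s => by
    by_cases hs : 1 ≤ s
    · have h1 := (H.antisymm_sum (T := i + j - 4 - s) (A := i + j - 3)
        (quarticCoef_reflect hj hij hs) fun a ha => quarticCoef_of_lt hj hij hs ha).mul_right
          (M 2 s)
      simpa only [smul_mul_assoc, one_mul] using h1
    · rw [H.of_nonpos 2 s (by omega)]
      simp only [mul_zero, smul_zero]
      exact OpHasSum.of_eq_zero fun _ => rfl
  refine (hX.fiberwise h).unique (OpHasSum.single_of_eq (i + j - 4) (fun s hs => ?_) ?_)
  · rw [if_neg (by omega), zero_smul]
  · rw [if_pos (by ring)]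

theorem lie_three_mul_sum (H : IsCurrentTower α b J M) {i j : ℤ} (hj : 1 ≤ j)
    (hij : j < i) (s : ℤ) :
    OpHasSum (fun a => ((currentCoef (i - s - 1) j a -
        (if 0 ≤ i + j - 4 - s - a then swapCoef i j s else 0) : ℤ) : K) •
          (J a * J (i + j - 4 - s - a) * M 2 s))
      (⁅J (i - s - 1), M 3 j⁆ * M 2 s -
        (b * ((currentLin (i - s - 1) j - swapCoef i j s * (i + j - 3 - s) : ℤ) : K)) •
          (J (i + j - 4 - s) * M 2 s) -
        (b ^ 2 * ((if j + (i - s - 1) = 3 ∧ i - s - 1 < 0 then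
          (j - 1) * (j - 2) * (i - s - 1) else 0 : ℤ) : K)) • M 2 s -
        α • (swapCoef i j s : K) • (M 2 (i + j - 2 - s) * M 2 s)) := by
  have h1 := (H.lie_three (i - s - 1) hj).mul_right (M 2 s)
  have h2 : OpHasSum (fun a => ((if 0 ≤ i + j - 4 - s - a then swapCoef i j s else 0 : ℤ) : K) •
      (J a * J (i + j - 4 - s - a) * M 2 s))
      ((swapCoef i j s : K) • ((α • M 2 (i + j - 2 - s) - (b * ((i + j - 3 - s : ℤ) : K)) •
        J (i + j - 4 - s)) * M 2 s)) := by
    by_cases hs : swapCoef i j s = 0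
    · rw [hs]
      simp only [ite_self, Int.cast_zero, zero_smul]
      exact OpHasSum.of_eq_zero fun _ => rfl
    · obtain ⟨h3, h4⟩ := swapCoef_ne_zero hj hij hs
      convert ((H.base_sum (i := i + j - 2 - s) (by omega)).mul_right (M 2 s)).smul
        (swapCoef i j s : K) using 1
      · funext a
        rw [show i + j - 2 - s - 2 - a = i + j - 4 - s - a by ring]
        split_ifs <;> simp
      · rw [show i + j - 2 - s - 2 = i + j - 4 - s by ring]
        push_cast
        congr 5
        ring
  convert h1.sub h2 using 1
  · funext a
    rw [show j + (i - s - 1) - 3 - a = i + j - 4 - s - a by ring, smul_mul_assoc, ← sub_smul,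
      ← Int.cast_sub]
  · rw [show j + (i - s - 1) - 3 = i + j - 4 - s by ring]
    simp only [sub_mul, smul_mul_assoc, one_mul]
    push_cast
    module

theorem mul_lie_two_sum [CharZero K] (H : IsCurrentTower α b J M) {i j : ℤ} (hj : 1 ≤ j)
    (t : ℤ) :
    OpHasSum (fun s => (((if 1 ≤ t + 3 - j then
        quadCoef (fun n => t + 3 - j - n) (t + 3 - j) j s else 0) -
          (if 1 ≤ t + 1 then structCoef i j (t + 1) else 0) : ℤ) : K) •
            (J (i + j - 4 - t) * J (t - s) * M 2 s))
      (J (i + j - 4 - t) * ⁅M 2 (t + 3 - j), M 3 j⁆ -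
        ((if 1 ≤ t + 1 then structCoef i j (t + 1) else 0 : ℤ) : K) •
          (J (i + j - 4 - t) * M 3 (t + 1)) -
        (b * (((if 1 ≤ t + 3 - j then (t + 3 - j - 1) * (t + 3 - j - 2) +
          (j - 1) * (t + 3 - j - (j - 1)) else 0) - structCoef i j (t + 1) * t : ℤ) : K)) •
          (J (i + j - 4 - t) * M 2 t)) := by
  have h1 : OpHasSum (fun s => ((if 1 ≤ t + 3 - j then
      quadCoef (fun n => t + 3 - j - n) (t + 3 - j) j s else 0 : ℤ) : K) •
        (J (i + j - 4 - t) * (J (t - s) * M 2 s)))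
      (J (i + j - 4 - t) * (⁅M 2 (t + 3 - j), M 3 j⁆ -
        (b * ((if 1 ≤ t + 3 - j then (t + 3 - j - 1) * (t + 3 - j - 2) +
          (j - 1) * (t + 3 - j - (j - 1)) else 0 : ℤ) : K)) • M 2 t)) := by
    by_cases ht : 1 ≤ t + 3 - j
    · simp only [if_pos ht]
      convert (H.lie_succ (m := 2) (by norm_num) ht hj (fun n => t + 3 - j - n)
        fun n hn => H.lie_two_two ht hn).mul_left (J (i + j - 4 - t)) using 1
      · funext s
        rw [mul_smul_comm, show t + 3 - j + j - 3 - s = t - s by ring]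
      · rw [show t + 3 - j + j - 3 = t by ring]
    · simp only [if_neg ht, H.of_nonpos 2 (t + 3 - j) (by omega)]
      rw [commutator_swap, commutator_zero]
      simp only [Int.cast_zero, zero_smul, mul_zero, neg_zero, sub_zero]
      exact OpHasSum.of_eq_zero fun _ => rfl
  have h2 : OpHasSum (fun s => ((if 1 ≤ t + 1 then structCoef i j (t + 1) else 0 : ℤ) : K) •
        (J (i + j - 4 - t) * (J (t - s) * M 2 s)))
      (((if 1 ≤ t + 1 then structCoef i j (t + 1) else 0 : ℤ) : K) •
        (J (i + j - 4 - t) * (M 3 (t + 1) - (b * (t : K)) • M 2 t))) := by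
    by_cases ht : 1 ≤ t + 1
    · convert ((H.step 2 (by norm_num) (t + 1) ht).mul_left (J (i + j - 4 - t))).smul
        ((if 1 ≤ t + 1 then structCoef i j (t + 1) else 0 : ℤ) : K) using 1
      · funext s
        rw [show t + 1 - s - 1 = t - s by ring]
      · rw [add_sub_cancel_right]
        push_cast
        rw [add_sub_cancel_right]
    · simp only [if_neg ht, Int.cast_zero, zero_smul]
      exact OpHasSum.of_eq_zero fun _ => rfl
  convert h1.sub h2 using 1
  · funext s
    rw [← sub_smul, ← Int.cast_sub, mul_assoc]
  · by_cases ht : 1 ≤ t + 1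
    · rw [if_pos ht]
      simp only [mul_sub, mul_smul_comm, smul_sub]
      push_cast
      module
    · rw [if_neg ht, H.of_nonpos 2 t (by omega)]
      simp

/-- The relation for `[M⁽³⁾_i, M⁽³⁾_j]`. -/
theorem structCoef_sum_three [CharZero K] (H : IsCurrentTower α b J M) {i j : ℤ}
    (hj : 1 ≤ j) (hij : j < i) :
    OpHasSum (fun l => ((if 1 ≤ l then structCoef i j l else 0 : ℤ) : K) •
        (J (i + j - 3 - l) * M 3 l))
      (⁅M 3 i, M 3 j⁆ - (b * (((i - j) * (i + j - 3) : ℤ) : K)) • M 3 (i + j - 3)) := by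
  have hfin₁ := fun v => H.finite_support_quadratic (m := 2) (by norm_num)
    (G := fun s a => currentCoef (i - s - 1) j a -
      (if 0 ≤ i + j - 4 - s - a then swapCoef i j s else 0)) (T := i + j - 4) (A := i + j - 3)
    (fun s a hs ha => by
      rw [currentCoef_of_lt (by omega) (by omega), if_neg (by omega), sub_zero]) v
  have hfin₂ := fun v => H.finite_support_quadratic (m := 2) (by norm_num)
    (G := fun s a => (if 1 ≤ i - 1 - a then
      quadCoef (fun n => i - 1 - a - n) (i - 1 - a) j s else 0) -
        (if 1 ≤ i + j - 3 - a then structCoef i j (i + j - 3 - a) else 0))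
    (T := i + j - 4) (A := i + j - 3)
    (fun s a hs ha => by
      rw [if_neg (by omega), if_neg (by omega), sub_zero]) v
  obtain ⟨X₁, hX₁⟩ := OpHasSum.exists_of_finite hfin₁
  obtain ⟨X₂, hX₂⟩ := OpHasSum.exists_of_finite hfin₂
  have hX := H.quarticCoef_sum hj hij ((hX₁.add hX₂).congr fun x => by
    rw [← add_smul, ← Int.cast_add]
    congr 2
    unfold quarticCoef
    ring)
  have h1 := hX₁.fiberwise fun s => H.lie_three_mul_sum hj hij s
  have h2 := (hX₂.comp_equiv (((Equiv.subLeft (i + j - 4)).prodCongr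
    (Equiv.refl ℤ)).trans (Equiv.prodComm ℤ ℤ))).fiberwise fun t =>
      (H.mul_lie_two_sum hj (i := i) t).congr fun s => by
        simp only [Equiv.trans_apply, Equiv.prodCongr_apply, Prod.map_apply, Equiv.refl_apply,
          Equiv.prodComm_apply, Prod.swap_prod_mk, Equiv.subLeft_apply]
        rw [show i + j - 4 - s - (i + j - 4 - t) = t - s by ring,
          show i - 1 - (i + j - 4 - t) = t + 3 - j by ring,
          show i + j - 3 - (i + j - 4 - t) = t + 1 by ring]
  have h3 := (H.comm_step (M 3 j) (m := 2) (i := i) (by norm_num) (by omega)).neg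
  obtain ⟨XA, hXA⟩ := OpHasSum.exists_of_finite
    fun v => H.finite_support_mul (m := 2) (by norm_num) (fun s => ⁅J (i - s - 1), M 3 j⁆) v
  have h4 := (h3.sub hXA).comp_equiv (Equiv.addRight (3 - j))
  have h5 : OpHasSum (fun s => (((i - j) * (i + j - 3) : ℤ) : K) • (J (i + j - 4 - s) * M 2 s))
      ((((i - j) * (i + j - 3) : ℤ) : K) • M 3 (i + j - 3) -
        (b * (((i - j) * (i + j - 3) * (i + j - 4) : ℤ) : K)) • M 2 (i + j - 4)) := by
    by_cases hN : i + j - 3 = 0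
    · rw [hN]
      simp only [mul_zero, zero_mul, Int.cast_zero, zero_smul, sub_zero]
      exact OpHasSum.of_eq_zero fun _ => rfl
    · convert (H.step 2 (by norm_num) (i + j - 3) (by omega)).smul
        (((i - j) * (i + j - 3) : ℤ) : K) using 1
      · funext s
        rw [show i + j - 3 - s - 1 = i + j - 4 - s by ring]
      · rw [show i + j - 3 - 1 = i + j - 4 by ring]
        push_cast
        module
  have h6 := (H.lie_succ (m := 2) (i := i - 1) (by norm_num) (by omega) hj
    (fun n => i - 1 - n) fun n hn => H.lie_two_two (by omega) hn).smul ((i - 1 : ℤ) : K)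
  have h7 : OpHasSum (fun s => (b ^ 2 * ((if j + (i - s - 1) = 3 ∧ i - s - 1 < 0 then
      (j - 1) * (j - 2) * (i - s - 1) else 0 : ℤ) : K)) • M 2 s)
      ((b ^ 2 * (((j - 1) * (j - 2) * (3 - j) : ℤ) : K)) • M 2 (i + j - 4)) := by
    refine OpHasSum.single_of_eq (i + j - 4) (fun s hs => ?_) ?_
    · rw [if_neg (by omega), Int.cast_zero, mul_zero, zero_smul]
    · congr 3
      by_cases h : 3 < j
      · rw [if_pos (by omega)]
        ring
      · rw [if_neg (by omega)]
        obtain rfl | rfl | rfl : j = 1 ∨ j = 2 ∨ j = 3 := by omega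
        all_goals ring
  have h8 := (H.swapCoef_sum hj hij).smul α
  have h9 : X₁ + X₂ + α • ((((∑ᶠ s, swapCoef i j s * (i + j - 2 - 2 * s) : ℤ) : K) / 2) •
      M 2 (i + j - 4)) = 0 := by
    rw [hX]
    by_cases hT : 1 ≤ i + j - 4
    · rw [smul_smul, ← add_smul, eq_neg_of_add_eq_zero_left
        (finsum_quarticCoef_add_finsum_swapCoef hj hij hT)]
      convert zero_smul K _ using 2
      push_cast
      ring
    · rw [H.of_nonpos 2 _ (by omega)]
      simp
  have h10 := ((((((hXA.add h4).sub (h1.add h2)).sub (h5.smul b)).add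
    (h6.smul b)).sub h7).sub h8).comp_equiv (Equiv.addRight (-1))
  convert h10 using 1
  · funext l
    obtain ⟨s, rfl⟩ : ∃ s, l = s + 1 := ⟨l - 1, by ring⟩
    simp only [Equiv.coe_addRight, add_neg_cancel_right]
    rw [commutator_swap (M 3 j), commutator_swap (M 3 j),
      show i - (s + (3 - j)) - 1 = i + j - 4 - s by ring,
      show i + j - 3 - (s + 1) = i + j - 4 - s by ring, show s + (3 - j) = s + 3 - j by ring,
      show i - 1 + j - 3 - s = i + j - 4 - s by ring]
    by_cases hs : 1 ≤ s
    · have h11 := congrArg (Int.cast (R := K)) (cubicLin_eq hj hij hs)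
      rw [if_pos (show 1 ≤ s + 1 by omega)]
      simp only [neg_mul, mul_neg]
      push_cast at h11 ⊢
      linear_combination (norm := module) (-b * h11) • (J (i + j - 4 - s) * M 2 s)
    · rw [H.of_nonpos 2 s (by omega)]
      simp only [mul_zero, smul_zero, neg_mul, mul_neg]
      module
  · have h11 := congrArg (Int.cast (R := K)) (cubicScalar_eq i j)
    rw [commutator_swap (M 3 j) (M 3 i), commutator_swap (M 3 j) (M 2 _),
      eq_neg_of_add_eq_zero_left h9, show i - 1 + j - 3 = i + j - 4 by ring]
    push_cast at h11 ⊢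
    linear_combination (norm := module) (b ^ 2 * h11) • M 2 (i + j - 4)

end IsCurrentTower

/-- The operator `D̃_{ij,l}(3)` for `j < i`. -/
def cubicStruct {K V : Type*} [Field K] [AddCommGroup V] [Module K V] (b : K)
    (J : ℤ → Module.End K V) (i j l : ℤ) : Module.End K V :=
  (structCoef i j l : K) • J (i + j - 3 - l) +
    (b * (((i - j) * (i + j - 3) : ℤ) : K)) •
      (if l = i + j - 3 then (1 : Module.End K V) else 0)

namespace IsCurrentTower

variable {K V : Type*} [Field K] [AddCommGroup V] [Module K V] {α b : K}
  {J : ℤ → Module.End K V} {M : ℕ → ℤ → Module.End K V}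

theorem cubicStruct_mul_sum {i j : ℤ} (hj : 1 ≤ j) (hij : j < i) {Y : ℤ → Module.End K V}
    {X : Module.End K V}
    (h : OpHasSum (fun l => ((if 1 ≤ l then structCoef i j l else 0 : ℤ) : K) •
        (J (i + j - 3 - l) * Y l))
      (X - (b * (((i - j) * (i + j - 3) : ℤ) : K)) • Y (i + j - 3))) :
    OpHasSum (fun l => if 1 ≤ l then cubicStruct b J i j l * Y l else 0) X := by
  have h1 : OpHasSum (fun l => if 1 ≤ l then (b * (((i - j) * (i + j - 3) : ℤ) : K)) •
      ((if l = i + j - 3 then (1 : Module.End K V) else 0) * Y l) else 0)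
      ((b * (((i - j) * (i + j - 3) : ℤ) : K)) • Y (i + j - 3)) := by
    refine OpHasSum.single_of_eq (i + j - 3) (fun l hl => ?_) ?_
    · rw [if_neg hl, zero_mul, smul_zero, ite_self]
    · rw [if_pos rfl, one_mul]
      split_ifs with hN
      · rfl
      · rw [show i + j - 3 = 0 by omega]
        simp
  convert h.add h1 using 1
  · funext l
    by_cases hl : 1 ≤ l
    · rw [if_pos hl, if_pos hl, if_pos hl, cubicStruct, add_mul, smul_mul_assoc, smul_mul_assoc]
    · simp [hl]
  · abel

theorem cubicStruct_sum_currents [CharZero K] (H : IsCurrentTower α b J M) {i j : ℤ}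
    (hj : 1 ≤ j) (hij : j < i) :
    OpHasSum (fun l => if 1 ≤ l then cubicStruct b J i j l * J l else 0)
      (⁅J i, M 3 j⁆ + ⁅M 3 i, J j⁆) := by
  refine cubicStruct_mul_sum hj hij ?_
  simpa only [add_zero, commutator_swap (M 3 i), sub_eq_add_neg] using
    H.structCoef_sum_currents hj hij (Or.inl rfl)

theorem cubicStruct_sum_one [CharZero K] (H : IsCurrentTower α b J M) {i j : ℤ}
    (hj : 1 ≤ j) (hij : j < i) :
    OpHasSum (fun l => if 1 ≤ l then cubicStruct b J i j l * M 1 l else 0)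
      (⁅M 1 i, M 3 j⁆ + ⁅M 3 i, M 1 j⁆) := by
  refine cubicStruct_mul_sum hj hij ?_
  convert (H.structCoef_sum_currents hj hij (Or.inr rfl)).smul α⁻¹ using 1
  · funext l
    by_cases hl : 1 ≤ l
    · rw [← sub_eq_add_neg l, ← H.base l hl, mul_smul_comm, smul_comm _ α,
        inv_smul_smul₀ H.ne_zero]
    · rw [if_neg hl]
      simp
  · rw [← sub_eq_add_neg i, ← sub_eq_add_neg j, ← H.base i (by omega), ← H.base j hj,
      smul_commutator, smul_commutator, commutator_swap (M 3 i)]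
    by_cases hN : i + j - 3 = 0
    · rw [hN]
      simp only [mul_zero, Int.cast_zero, zero_smul, sub_zero]
      rw [← smul_sub, inv_smul_smul₀ H.ne_zero, sub_eq_add_neg]
    · rw [← sub_eq_add_neg (i + j - 3), ← H.base _ (by omega), smul_comm _ α, ← smul_sub,
        ← smul_sub, inv_smul_smul₀ H.ne_zero, sub_eq_add_neg ⁅M 1 i, M 3 j⁆]

theorem cubicStruct_sum_two [CharZero K] (H : IsCurrentTower α b J M) {i j : ℤ}
    (hj : 1 ≤ j) (hij : j < i) :
    OpHasSum (fun l => if 1 ≤ l then cubicStruct b J i j l * M 2 l else 0)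
      (⁅M 2 i, M 3 j⁆ + ⁅M 3 i, M 2 j⁆ - ((i - j : ℤ) : K) • M 3 (i + j - 2)) :=
  cubicStruct_mul_sum hj hij (H.structCoef_sum_two hj hij)

theorem cubicStruct_sum_three [CharZero K] (H : IsCurrentTower α b J M) {i j : ℤ}
    (hj : 1 ≤ j) (hij : j < i) :
    OpHasSum (fun l => if 1 ≤ l then cubicStruct b J i j l * M 3 l else 0) ⁅M 3 i, M 3 j⁆ :=
  cubicStruct_mul_sum hj hij (H.structCoef_sum_three hj hij)

theorem lie_currents_two (H : IsCurrentTower α b J M) {i j : ℤ} (hi : 1 ≤ i) (hj : 1 ≤ j) :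
    ⁅J i, M 2 j⁆ + ⁅M 2 i, J j⁆ = ((i - j : ℤ) : K) • J (i + j - 2) := by
  rw [commutator_swap (M 2 i), H.lie_two i hj, H.lie_two j hi]
  rw [if_pos (show 2 ≤ j + i by omega), if_pos (show 2 ≤ i + j by omega),
    if_neg (show ¬ i < 0 by omega), if_neg (show ¬ j < 0 by omega),
    if_neg (show ¬ (j + i = 2 ∧ i < 0) by omega), if_neg (show ¬ (i + j = 2 ∧ j < 0) by omega),
    add_comm j i]
  push_cast
  module

theorem lie_one_two (H : IsCurrentTower α b J M) {i j : ℤ} (hi : 1 ≤ i) (hj : 1 ≤ j) :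
    ⁅M 1 i, M 2 j⁆ + ⁅M 2 i, M 1 j⁆ = ((i - j : ℤ) : K) • M 1 (i + j - 2) := by
  rw [commutator_swap (M 1 i), H.lie_two_one hi hj, H.lie_two_one hj hi, add_comm j i]
  push_cast
  module

theorem lie_currents_one (H : IsCurrentTower α b J M) {i j : ℤ} (hi : 1 ≤ i) (hj : 1 ≤ j) :
    ⁅J i, M 1 j⁆ + ⁅M 1 i, J j⁆ = 0 := by
  rw [commutator_swap (M 1 i), H.lie_one i hj, H.lie_one j hi, if_neg (by omega),
    if_neg (by omega)]
  simp

theorem lie_one_one (H : IsCurrentTower α b J M) {i j : ℤ} (hi : 1 ≤ i) (hj : 1 ≤ j) :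
    ⁅M 1 i, M 1 j⁆ = 0 := by
  refine H.smul_cancel ?_
  rw [← smul_commutator, H.base i hi, H.lie_one _ hj]
  split_ifs with h
  · rw [show i - 1 = 0 by omega]
    simp
  · simp

theorem lie_currents (H : IsCurrentTower α b J M) {i j : ℤ} (hi : 1 ≤ i) (hj : 1 ≤ j) :
    ⁅J i, J j⁆ = 0 := by
  rw [H.comm, if_neg (by omega), zero_smul]

end IsCurrentTower

section ConcreteTower

/-- A family over `ℤ` vanishing off the positive integers has the same sum as its restriction to
`ℕ`. -/
theorem finHasSum_natCast_iff {A : Type*} [AddCommGroup A] {g : ℤ → A} {a : A}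
    (hg : ∀ l, l ≤ 0 → g l = 0) : FinHasSum (fun n : ℕ => g n) a ↔ FinHasSum g a := by
  have hs : Function.support g = Nat.cast '' Function.support fun n : ℕ => g n := by
    ext l
    constructor
    · intro hl
      have : 0 < l := by
        by_contra h
        exact hl (hg l (by omega))
      exact ⟨l.toNat, by simpa [Int.toNat_of_nonneg this.le] using hl,
        Int.toNat_of_nonneg this.le⟩
    · rintro ⟨n, hn, rfl⟩
      exact hn
  have h1 : ∑ᶠ n : ℕ, g n = ∑ᶠ l, g l := by
    rw [← finsum_mem_range (f := g) (g := (Nat.cast : ℕ → ℤ)) Nat.cast_injective,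
      ← finsum_mem_univ (f := g)]
    refine finsum_mem_inter_support_eq g _ _ ?_
    rw [Set.univ_inter, Set.inter_eq_right, hs]
    exact Set.image_subset_range _ _
  unfold FinHasSum
  rw [hs, h1, Set.finite_image_iff Nat.cast_injective.injOn]

/-- Currents assembled from annihilation operators `P` and creation operators `Q` satisfying the
canonical commutation relations form a Heisenberg family. -/
theorem commutator_of_canonical {K V : Type*} [Field K] [AddCommGroup V] [Module K V] {α u : K}
    {P Q : ℕ → Module.End K V} {J : ℤ → Module.End K V}
    (hPP : ∀ i j, 0 < i → 0 < j → P i * P j = P j * P i)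
    (hQQ : ∀ i j, 0 < i → 0 < j → Q i * Q j = Q j * Q i)
    (hPQ : ∀ i j, 0 < i → 0 < j → ⁅P i, Q j⁆ = if i = j then 1 else 0)
    (hpos : ∀ m : ℤ, 0 < m → J m = (α * (m : K)) • P m.toNat)
    (hneg : ∀ m : ℤ, m < 0 → J m = Q (-m).toNat) (hzero : J 0 = u • 1) (m n : ℤ) :
    ⁅J m, J n⁆ = (if m + n = 0 then α * (m : K) else 0) • (1 : Module.End K V) := by
  have hmix : ∀ m n : ℤ, 0 < m → n < 0 →
      ⁅J m, J n⁆ = (if m + n = 0 then α * (m : K) else 0) • (1 : Module.End K V) := by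
    intro m n hm hn
    rw [hpos m hm, hneg n hn, smul_commutator, hPQ _ _ (by omega) (by omega)]
    by_cases h : m + n = 0
    · rw [if_pos h, if_pos (by omega)]
    · rw [if_neg h, if_neg (by omega), smul_zero, zero_smul]
  rcases lt_trichotomy m 0 with hm | rfl | hm
  · rcases lt_trichotomy n 0 with hn | rfl | hn
    · rw [hneg m hm, hneg n hn, Ring.lie_def, hQQ _ _ (by omega) (by omega), sub_self,
        if_neg (by omega), zero_smul]
    · rw [hzero, commutator_smul, if_neg (by omega)]
      simp [Ring.lie_def]
    · rw [commutator_swap, hmix n m hn hm, ← neg_smul]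
      congr 1
      by_cases h : m + n = 0
      · obtain rfl : m = -n := by omega
        simp
      · rw [if_neg h, if_neg (by omega), neg_zero]
  · rw [hzero, smul_commutator]
    simp [Ring.lie_def]
  · rcases lt_trichotomy n 0 with hn | rfl | hn
    · exact hmix m n hm hn
    · rw [hzero, commutator_smul, if_neg (by omega)]
      simp [Ring.lie_def]
    · rw [hpos m hm, hpos n hn, smul_commutator, commutator_smul, Ring.lie_def,
        hPP _ _ (by omega) (by omega), sub_self, if_neg (by omega), smul_zero, smul_zero,
        zero_smul]

variable {K : Type} [Field K]

theorem pderivN_coe (k : ℕ+) (f : Rp K) : pderivN K k f = MvPolynomial.pderiv k f := by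
  have h : pderivN K k = (MvPolynomial.pderiv k).toLinearMap := dif_pos k.pos
  rw [h]
  rfl

theorem mulpN_coe (k : ℕ+) (f : Rp K) : mulpN K k f = MvPolynomial.X k * f := by
  have h : mulpN K k = LinearMap.mulLeft K (MvPolynomial.X k) := dif_pos k.pos
  rw [h]
  rfl

theorem pderivN_mul_pderivN {i j : ℕ} (hi : 0 < i) (hj : 0 < j) :
    pderivN K i * pderivN K j = pderivN K j * pderivN K i := by
  lift i to ℕ+ using hi
  lift j to ℕ+ using hj
  refine LinearMap.ext fun f => ?_
  simp only [Module.End.mul_apply, pderivN_coe]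
  have h : ⁅MvPolynomial.pderiv (R := K) i, MvPolynomial.pderiv (R := K) j⁆ = 0 := by
    refine MvPolynomial.derivation_ext fun k => ?_
    classical
    rw [Derivation.commutator_apply, MvPolynomial.pderiv_X, MvPolynomial.pderiv_X,
      Pi.single_apply, Pi.single_apply]
    split_ifs <;> simp
  have h1 := congrArg (fun D : Derivation K (Rp K) (Rp K) => D f) h
  rwa [Derivation.commutator_apply, Derivation.coe_zero, Pi.zero_apply, sub_eq_zero] at h1

theorem mulpN_mul_mulpN {i j : ℕ} (hi : 0 < i) (hj : 0 < j) :
    mulpN K i * mulpN K j = mulpN K j * mulpN K i := by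
  lift i to ℕ+ using hi
  lift j to ℕ+ using hj
  refine LinearMap.ext fun f => ?_
  simp only [Module.End.mul_apply, mulpN_coe]
  ring

theorem pderivN_commutator_mulpN {i j : ℕ} (hi : 0 < i) (hj : 0 < j) :
    ⁅pderivN K i, mulpN K j⁆ = if i = j then 1 else 0 := by
  lift i to ℕ+ using hi
  lift j to ℕ+ using hj
  refine LinearMap.ext fun f => ?_
  have h : ⁅pderivN K i, mulpN K j⁆ f = MvPolynomial.pderiv i (MvPolynomial.X j) * f := by
    simp only [Ring.lie_def, LinearMap.sub_apply, Module.End.mul_apply, pderivN_coe, mulpN_coe,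
      Derivation.leibniz, smul_eq_mul]
    ring
  rw [h]
  classical
  rw [MvPolynomial.pderiv_X, Pi.single_apply]
  by_cases hij : i = j
  · subst hij
    simp
  · rw [if_neg (Ne.symm hij), if_neg (by simpa using hij), zero_mul, LinearMap.zero_apply]

theorem JopU_pos (b u : K) {m : ℤ} (hm : 0 < m) :
    JopU K b u m = ((1 + b) * (m : K)) • pderivN K m.toNat := by
  rw [JopU, if_neg (by omega), Jop, if_pos hm]

theorem JopU_commutator (b u : K) (m n : ℤ) :
    ⁅JopU K b u m, JopU K b u n⁆ = (if m + n = 0 then (1 + b) * (m : K) else 0) • 1 :=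
  commutator_of_canonical (fun _ _ => pderivN_mul_pderivN) (fun _ _ => mulpN_mul_mulpN)
    (fun _ _ => pderivN_commutator_mulpN) (fun _ => JopU_pos b u)
    (fun m hm => by rw [JopU, if_neg (by omega), Jop, if_neg (by omega)])
    (by rw [JopU, if_pos rfl]) m n

theorem JopU_eventually_eq_zero (b u : K) (f : Rp K) :
    ∀ᶠ k in Filter.atTop, JopU K b u k f = 0 := by
  classical
  filter_upwards [Filter.eventually_gt_atTop 0,
    Filter.eventually_gt_atTop ((f.vars.sup fun i => (i : ℕ) : ℕ) : ℤ)] with k hk hf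
  obtain ⟨k, rfl⟩ := Int.eq_ofNat_of_zero_le hk.le
  lift k to ℕ+ using by omega
  have h : k ∉ f.vars := fun h => by
    have h1 := Finset.le_sup (f := fun i : ℕ+ => (i : ℕ)) h
    omega
  rw [JopU_pos b u hk, LinearMap.smul_apply, Int.toNat_natCast, pderivN_coe,
    MvPolynomial.pderiv_eq_zero_of_notMem_vars h, smul_zero]

theorem smul_pstar (b u : K) {i : ℕ} (hi : 1 ≤ i) :
    ((1 : K) + b) • pstar K i = JopU K b u i := by
  rw [JopU_pos b u (by omega), pstar, smul_smul, Int.toNat_natCast, Int.cast_natCast]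

theorem isCurrentTower_JopU (b u : K) (hb : (1 : K) + b ≠ 0)
    (Mv : ℕ → ℕ → Module.End K (Rp K))
    (hbase1 : ∀ i : ℕ, 1 ≤ i → Mv 1 i = ((1 : K) + b)⁻¹ • JopU K b u ((i : ℤ) - 1))
    (hbase0 : ∀ m : ℕ, 1 ≤ m → Mv m 0 = 0)
    (hfin : ∀ (m i : ℕ) (f : Rp K),
      (Set.Ici 1 ∩ Function.support fun n : ℕ =>
        (JopU K b u ((i : ℤ) - (n : ℤ) - 1)) ((Mv m n) f)).Finite)
    (hrec : ∀ m : ℕ, 1 ≤ m → ∀ i : ℕ, 1 ≤ i → ∀ f : Rp K,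
      (Mv (m + 1) i) f =
        (∑ᶠ n ∈ Set.Ici (1 : ℕ), (JopU K b u ((i : ℤ) - (n : ℤ) - 1)) ((Mv m n) f)) +
          (b * ((i : K) - 1)) • (Mv m (i - 1)) f) :
    IsCurrentTower (1 + b) b (JopU K b u) fun m i => if 1 ≤ i then Mv m i.toNat else 0 where
  ne_zero := hb
  comm := JopU_commutator b u
  eventually_eq_zero := JopU_eventually_eq_zero b u
  of_nonpos m i hi := if_neg (by omega)
  base i hi := by
    rw [if_pos hi, hbase1 _ (by omega), smul_inv_smul₀ hb, Int.toNat_of_nonneg (by omega)]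
  step m hm i hi f := by
    refine (finHasSum_natCast_iff fun l hl => ?_).1 ?_
    · beta_reduce
      rw [if_neg (by omega), mul_zero, LinearMap.zero_apply]
    obtain ⟨i, rfl⟩ := Int.eq_ofNat_of_zero_le (show 0 ≤ i by omega)
    have h0 : (if 1 ≤ (i : ℤ) - 1 then Mv m ((i : ℤ) - 1).toNat else 0) = Mv m (i - 1) := by
      split_ifs with h
      · congr 1
        omega
      · rw [show i - 1 = 0 by omega, hbase0 m hm]
    have h1 : (fun n : ℕ => (JopU K b u ((i : ℤ) - n - 1) *
        if 1 ≤ (n : ℤ) then Mv m (n : ℤ).toNat else 0) f) = (Set.Ici (1 : ℕ)).indicator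
          fun n : ℕ => (JopU K b u ((i : ℤ) - (n : ℤ) - 1)) ((Mv m n) f) := by
      funext n
      rw [Set.indicator_apply]
      by_cases hn : 1 ≤ n
      · rw [if_pos (by omega), if_pos (Set.mem_Ici.2 hn)]
        rfl
      · rw [if_neg (by omega), if_neg (by simpa using hn)]
        simp
    rw [if_pos hi, h0, h1]
    refine ⟨?_, ?_⟩
    · rw [Set.support_indicator]
      exact hfin m i f
    · rw [← finsum_mem_def, LinearMap.sub_apply, LinearMap.smul_apply, Int.toNat_natCast,
        hrec m hm i (by omega), Int.cast_natCast, add_sub_cancel_right]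

end ConcreteTower

section GradedEmbedding

variable {K V W : Type*} [Field K] [AddCommGroup V] [Module K V] [AddCommGroup W] [Module K W]
  {E : ℕ → Module.End K V →ₗ[K] Module.End K W}

/-- The commutator of two cubic polynomials in a central variable whose `k`-th power times an
operator `x` is represented by `E k x`. -/
theorem cubic_commutator (hE : ∀ a c x y, E a x * E c y = E (a + c) (x * y)) (q₁ q₂ q₃ : K)
    (x₀ x₁ x₂ x₃ y₀ y₁ y₂ y₃ : Module.End K V) :
    ⁅E 0 x₀ + q₁ • E 1 x₁ + q₂ • E 2 x₂ + q₃ • E 3 x₃,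
        E 0 y₀ + q₁ • E 1 y₁ + q₂ • E 2 y₂ + q₃ • E 3 y₃⁆ =
      E 0 ⁅x₀, y₀⁆ + q₁ • E 1 (⁅x₀, y₁⁆ + ⁅x₁, y₀⁆) + (q₁ * q₁) • E 2 ⁅x₁, y₁⁆ +
        q₂ • E 2 (⁅x₀, y₂⁆ + ⁅x₂, y₀⁆) + (q₁ * q₂) • E 3 (⁅x₁, y₂⁆ + ⁅x₂, y₁⁆) +
        (q₂ * q₂) • E 4 ⁅x₂, y₂⁆ + q₃ • E 3 (⁅x₀, y₃⁆ + ⁅x₃, y₀⁆) +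
        (q₁ * q₃) • E 4 (⁅x₁, y₃⁆ + ⁅x₃, y₁⁆) + (q₂ * q₃) • E 5 (⁅x₂, y₃⁆ + ⁅x₃, y₂⁆) +
        (q₃ * q₃) • E 6 ⁅x₃, y₃⁆ := by
  simp only [Ring.lie_def, mul_add, add_mul, smul_mul_assoc, mul_smul_comm, hE, map_add, map_sub,
    Nat.reduceAdd]
  module

theorem IsCurrentTower.cubic_closure [CharZero K] {α b : K} {J : ℤ → Module.End K V}
    {M : ℕ → ℤ → Module.End K V} (H : IsCurrentTower α b J M)
    (hE : ∀ a c x y, E a x * E c y = E (a + c) (x * y)) {S : Set W}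
    (hS : ∀ (k : ℕ) (f : ℤ → Module.End K V) (X : Module.End K V), OpHasSum f X → ∀ w ∈ S,
      FinHasSum (fun l => E k (f l) w) (E k X w))
    (q₁ q₂ q₃ : K) {P : ℤ → Module.End K V} (hP : ∀ l, 1 ≤ l → α • P l = J l)
    {L : ℤ → Module.End K W} (hL : ∀ l, 1 ≤ l →
      L l = E 0 (-P l) + q₁ • E 1 (M 1 l) + q₂ • E 2 (M 2 l) + q₃ • E 3 (M 3 l))
    {i j : ℤ} (hj : 1 ≤ j) (hij : j < i) :
    ∃ X, ⁅L i, L j⁆ = E 1 1 * X ∧ ∀ w ∈ S, FinHasSum (fun l => if 1 ≤ l then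
      (q₂ • E 1 (if l = i + j - 2 then ((i - j : ℤ) : K) • 1 else 0) +
        q₃ • E 2 (cubicStruct b J i j l)) (L l w) else 0) (X w) := by
  have hi : 1 ≤ i := by omega
  have hα : ∀ {l}, 1 ≤ l → -P l = -α⁻¹ • J l := fun {l} hl => by
    rw [← hP l hl, neg_smul, inv_smul_smul₀ H.ne_zero]
  have hD : ∀ Y : ℤ → Module.End K V, OpHasSum (fun l => if 1 ≤ l then
      (if l = i + j - 2 then ((i - j : ℤ) : K) • 1 else 0) * Y l else 0)
      (((i - j : ℤ) : K) • Y (i + j - 2)) := fun Y => by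
    refine OpHasSum.single_of_eq (i + j - 2) (fun n hn => ?_) ?_
    · rw [if_neg hn, zero_mul, ite_self]
    · rw [if_pos (by omega), if_pos rfl, smul_mul_assoc, one_mul]
  have hJ : OpHasSum (fun l => if 1 ≤ l then cubicStruct b J i j l * -P l else 0)
      (⁅-P i, M 3 j⁆ + ⁅M 3 i, -P j⁆) := by
    have h := (H.cubicStruct_sum_currents hj hij).smul (-α⁻¹)
    rw [smul_add, ← smul_commutator, ← commutator_smul, ← hα hi, ← hα hj] at h
    refine h.congr fun l => ?_
    split_ifs with hl
    · rw [hα hl, mul_smul_comm]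
    · rw [smul_zero]
  have h00 : ⁅-P i, -P j⁆ = 0 := by
    rw [hα hi, hα hj, smul_commutator, commutator_smul, H.lie_currents hi hj, smul_zero, smul_zero]
  have h01 : ⁅-P i, M 1 j⁆ + ⁅M 1 i, -P j⁆ = 0 := by
    rw [hα hi, hα hj, smul_commutator, commutator_smul, ← smul_add, H.lie_currents_one hi hj,
      smul_zero]
  have h02 : ⁅-P i, M 2 j⁆ + ⁅M 2 i, -P j⁆ = ((i - j : ℤ) : K) • -P (i + j - 2) := by
    rw [hα hi, hα hj, hα (by omega), smul_commutator, commutator_smul, ← smul_add,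
      H.lie_currents_two hi hj, smul_comm]
  refine ⟨q₂ • E 1 (((i - j : ℤ) : K) • -P (i + j - 2)) +
    (q₁ * q₂) • E 2 (((i - j : ℤ) : K) • M 1 (i + j - 2)) +
    (q₂ * q₂) • E 3 (((i - j : ℤ) : K) • M 2 (i + j - 2)) +
    (q₂ * q₃) • E 4 (((i - j : ℤ) : K) • M 3 (i + j - 2)) +
    q₃ • E 2 (⁅-P i, M 3 j⁆ + ⁅M 3 i, -P j⁆) +
    (q₁ * q₃) • E 3 (⁅M 1 i, M 3 j⁆ + ⁅M 3 i, M 1 j⁆) +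
    (q₂ * q₃) • E 4 (⁅M 2 i, M 3 j⁆ + ⁅M 3 i, M 2 j⁆ - ((i - j : ℤ) : K) • M 3 (i + j - 2)) +
    (q₃ * q₃) • E 5 ⁅M 3 i, M 3 j⁆, ?_, fun w hw => ?_⟩
  · rw [hL i hi, hL j hj, cubic_commutator hE, h00, h01, h02, H.lie_one_one hi hj,
      H.lie_one_two hi hj, H.lie_two_two hi hj]
    simp only [mul_add, mul_sub, mul_smul_comm, hE, one_mul, map_add, map_sub, map_zero,
      Nat.reduceAdd]
    module
  · have hs : ∀ (c : K) (k : ℕ) {f : ℤ → Module.End K V} {X : Module.End K V}, OpHasSum f X →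
        FinHasSum (fun l => (c • E k (f l)) w) ((c • E k X) w) := fun c k f X hf =>
      (hS k f X hf w hw).map (DistribSMul.toAddMonoidHom W c)
    have h := (((((((hs q₂ 1 (hD fun l => -P l)).add (hs (q₁ * q₂) 2 (hD (M 1)))).add
      (hs (q₂ * q₂) 3 (hD (M 2)))).add (hs (q₂ * q₃) 4 (hD (M 3)))).add (hs q₃ 2 hJ)).add
      (hs (q₁ * q₃) 3 (H.cubicStruct_sum_one hj hij))).add
      (hs (q₂ * q₃) 4 (H.cubicStruct_sum_two hj hij))).add
      (hs (q₃ * q₃) 5 (H.cubicStruct_sum_three hj hij))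
    simp only [← LinearMap.add_apply] at h
    convert h using 2 with l
    by_cases hl : 1 ≤ l
    · simp only [if_pos hl]
      rw [← Module.End.mul_apply, hL l hl]
      refine congrArg (fun X : Module.End K W => X w) ?_
      simp only [mul_add, add_mul, smul_mul_assoc, mul_smul_comm, hE, Nat.reduceAdd]
      module
    · simp only [if_neg hl, map_zero, smul_zero, add_zero, LinearMap.zero_apply]

end GradedEmbedding

section TrivalentModel

theorem FinHasSum.pi {ι κ : Type*} {A : κ → Type*} [∀ k, AddCommGroup (A k)]
    {f : ι → ∀ k, A k} {a : ∀ k, A k} (hf : (Function.support f).Finite)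
    (h : ∀ k, FinHasSum (fun n => f n k) (a k)) : FinHasSum f a := by
  refine ⟨hf, funext fun k => ?_⟩
  have h1 := (FinHasSum.of_finite hf).map (Pi.evalAddMonoidHom A k)
  exact h1.unique (h k)

variable {K : Type} [Field K]

/-- The operator `t ^ k · φ` on coefficient sequences, as a linear function of `φ`. -/
def shiftLift (k : ℕ) : Module.End K (Rp K) →ₗ[K] Module.End K (ℕ → Rp K) where
  toFun φ := tshift K ^ k * liftE K φ
  map_add' φ ψ := by
    rw [← mul_add]
    rfl
  map_smul' c φ := by
    rw [RingHom.id_apply, ← mul_smul_comm]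
    rfl

theorem shiftLift_apply (k : ℕ) (φ : Module.End K (Rp K)) :
    shiftLift k φ = tshift K ^ k * liftE K φ :=
  rfl

theorem commute_liftE_tshift (φ : Module.End K (Rp K)) : Commute (liftE K φ) (tshift K) := by
  refine LinearMap.ext fun F => funext fun n => ?_
  change φ (if n = 0 then 0 else F (n - 1)) = if n = 0 then 0 else φ (F (n - 1))
  split_ifs
  · exact map_zero φ
  · rfl

theorem shiftLift_mul_shiftLift (k m : ℕ) (φ ψ : Module.End K (Rp K)) :
    shiftLift k φ * shiftLift m ψ = shiftLift (k + m) (φ * ψ) := by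
  have h : liftE K (φ * ψ) = liftE K φ * liftE K ψ := rfl
  rw [shiftLift_apply, shiftLift_apply, shiftLift_apply, h, pow_add, mul_assoc, mul_assoc,
    ← mul_assoc (liftE K φ), ((commute_liftE_tshift φ).pow_right m).eq, mul_assoc]

theorem finHasSum_shiftLift (k : ℕ) {ι : Type*} {f : ι → Module.End K (Rp K)}
    {X : Module.End K (Rp K)} (hf : OpHasSum f X) {F : ℕ → Rp K}
    (hF : (Function.support F).Finite) :
    FinHasSum (fun l => shiftLift k (f l) F) (shiftLift k X F) := by
  refine FinHasSum.map (f := fun l => liftE K (f l) F) (tshift K ^ k).toAddMonoidHom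
    (FinHasSum.pi ?_ fun n => hf (F n))
  refine (hF.biUnion fun n _ => (hf (F n)).1).subset fun l hl => ?_
  obtain ⟨n, hn⟩ := Function.ne_iff.1 hl
  have hn' : f l (F n) ≠ 0 := hn
  refine Set.mem_biUnion (x := n) (fun h => hn' ?_) hn'
  rw [h, map_zero]

theorem Ltri_eq (q₁ q₂ q₃ : K) (Mv : ℕ → ℕ → Module.End K (Rp K)) (i : ℕ) :
    Ltri K q₁ q₂ q₃ Mv i = shiftLift 0 (-pstar K i) + q₁ • shiftLift 1 (Mv 1 i) +
      q₂ • shiftLift 2 (Mv 2 i) + q₃ • shiftLift 3 (Mv 3 i) := by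
  simp only [Ltri, shiftLift_apply, pow_zero, pow_one, one_mul]

theorem Dtcoef_two (b u : K) (i j l : ℕ) :
    Dtcoef K b u i j l 2 =
      if (l : ℤ) = (i : ℤ) + (j : ℤ) - 2 then (((i : ℤ) - (j : ℤ) : ℤ) : K) • 1 else 0 := by
  rw [Dtcoef, Int.cast_sub, Int.cast_natCast, Int.cast_natCast]

theorem Dtcoef_three_of_lt (b u : K) {i j : ℕ} (hij : j < i) (l : ℕ) :
    Dtcoef K b u i j l 3 = cubicStruct b (JopU K b u) i j l := by
  rw [Dtcoef, cubicStruct, structCoef, max_eq_left (by omega), min_eq_right (by omega),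
    Int.sign_eq_one_of_pos (by omega)]
  congr 2
  · push_cast
    simp only [mul_ite, mul_one, mul_zero, mul_add]
    ring_nf
  · push_cast
    ring

theorem Dtcoef_two_swap (b u : K) (i j l : ℕ) :
    Dtcoef K b u j i l 2 = -Dtcoef K b u i j l 2 := by
  rw [Dtcoef, Dtcoef, add_comm (j : ℤ)]
  split_ifs
  · module
  · exact neg_zero.symm

theorem Dtcoef_three_swap (b u : K) (i j l : ℕ) :
    Dtcoef K b u j i l 3 = -Dtcoef K b u i j l 3 := by
  rw [Dtcoef, Dtcoef, add_comm (j : ℤ), max_comm (j : ℤ), min_comm (j : ℤ), ← neg_sub (i : ℤ),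
    Int.sign_neg]
  push_cast
  module

theorem Dtcoef_two_self (b u : K) (i l : ℕ) : Dtcoef K b u i i l 2 = 0 := by
  rw [Dtcoef, sub_self, zero_smul, ite_self]

theorem Dtcoef_three_self (b u : K) (i l : ℕ) : Dtcoef K b u i i l 3 = 0 := by
  rw [Dtcoef]
  simp

/-- The operator `q₂·t·D̃_{ij,l}(2) + q₃·t²·D̃_{ij,l}(3)`. -/
def structOp (b u q₂ q₃ : K) (i j l : ℕ) : Module.End K (ℕ → Rp K) :=
  q₂ • (tshift K * liftE K (Dtcoef K b u i j l 2)) +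
    q₃ • (tshift K ^ 2 * liftE K (Dtcoef K b u i j l 3))

theorem structOp_eq (b u q₂ q₃ : K) (i j l : ℕ) :
    structOp b u q₂ q₃ i j l = q₂ • shiftLift 1 (Dtcoef K b u i j l 2) +
      q₃ • shiftLift 2 (Dtcoef K b u i j l 3) := by
  rw [structOp, shiftLift_apply, shiftLift_apply, pow_one]

theorem structOp_swap (b u q₂ q₃ : K) (i j l : ℕ) :
    structOp b u q₂ q₃ j i l = -structOp b u q₂ q₃ i j l := by
  rw [structOp_eq, structOp_eq, Dtcoef_two_swap, Dtcoef_three_swap, map_neg, map_neg]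
  module

theorem structOp_self (b u q₂ q₃ : K) (i l : ℕ) : structOp b u q₂ q₃ i i l = 0 := by
  rw [structOp_eq, Dtcoef_two_self, Dtcoef_three_self, map_zero, map_zero, smul_zero, smul_zero,
    add_zero]

theorem trivalent_closure_of_lt [CharZero K] (b u q₁ q₂ q₃ : K)
    {Mv : ℕ → ℕ → Module.End K (Rp K)}
    (H : IsCurrentTower (1 + b) b (JopU K b u)
      fun m i => if 1 ≤ i then Mv m i.toNat else 0) {i j : ℕ} (hj : 1 ≤ j) (hij : j < i)
    {F : ℕ → Rp K} (hF : (Function.support F).Finite) :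
    ∃ Y, ⁅Ltri K q₁ q₂ q₃ Mv i, Ltri K q₁ q₂ q₃ Mv j⁆ F = tshift K Y ∧
      FinHasSum ((Set.Ici 1).indicator fun l =>
        structOp b u q₂ q₃ i j l (Ltri K q₁ q₂ q₃ Mv l F)) Y := by
  obtain ⟨X, hX, hsum⟩ := H.cubic_closure shiftLift_mul_shiftLift
    (S := {F : ℕ → Rp K | (Function.support F).Finite})
    (fun k f X hf w hw => finHasSum_shiftLift k hf hw) q₁ q₂ q₃
    (P := fun l => pstar K l.toNat)
    (fun l hl => by
      rw [smul_pstar b u (by omega), Int.toNat_of_nonneg (by omega)])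
    (L := fun l => Ltri K q₁ q₂ q₃ Mv l.toNat)
    (fun l hl => by
      simp only [if_pos hl]
      exact Ltri_eq q₁ q₂ q₃ Mv l.toNat)
    (i := i) (j := j) (by omega) (by omega)
  have h1 : shiftLift 1 (1 : Module.End K (Rp K)) = tshift K := by
    rw [shiftLift_apply, pow_one]
    rfl
  refine ⟨X F, ?_, ?_⟩
  · rw [h1] at hX
    exact congrArg (fun Y : Module.End K (ℕ → Rp K) => Y F) hX
  · have h2 := (finHasSum_natCast_iff fun l hl => if_neg (by omega)).2 (hsum F hF)
    convert h2 using 2 with l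
    rw [Set.indicator_apply]
    by_cases hl : 1 ≤ l
    · rw [if_pos (Set.mem_Ici.2 hl), if_pos (by omega), structOp_eq, Dtcoef_two,
        Dtcoef_three_of_lt b u hij, Int.toNat_natCast]
    · rw [if_neg (by simpa using hl), if_neg (by omega)]

theorem trivalent_closure [CharZero K] (b u q₁ q₂ q₃ : K)
    {Mv : ℕ → ℕ → Module.End K (Rp K)}
    (H : IsCurrentTower (1 + b) b (JopU K b u)
      fun m i => if 1 ≤ i then Mv m i.toNat else 0) {i j : ℕ} (hi : 1 ≤ i) (hj : 1 ≤ j)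
    {F : ℕ → Rp K} (hF : (Function.support F).Finite) :
    ∃ Y, ⁅Ltri K q₁ q₂ q₃ Mv i, Ltri K q₁ q₂ q₃ Mv j⁆ F = tshift K Y ∧
      FinHasSum ((Set.Ici 1).indicator fun l =>
        structOp b u q₂ q₃ i j l (Ltri K q₁ q₂ q₃ Mv l F)) Y := by
  rcases lt_trichotomy i j with hij | rfl | hij
  · obtain ⟨Y, hY, hsum⟩ := trivalent_closure_of_lt b u q₁ q₂ q₃ H hi hij hF
    refine ⟨-Y, ?_, ?_⟩
    · rw [commutator_swap, LinearMap.neg_apply, hY, map_neg]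
    · have h1 := hsum.map (-AddMonoidHom.id _)
      convert h1 using 2 with l
      · simp only [Set.indicator_apply, structOp_swap b u q₂ q₃ j i]
        split_ifs <;> simp
      · rfl
  · refine ⟨0, by simp [Ring.lie_def], ?_⟩
    simp only [structOp_self, LinearMap.zero_apply, Set.indicator_zero]
    exact ⟨by simp, by simp⟩
  · exact trivalent_closure_of_lt b u q₁ q₂ q₃ H hj hij hF

end TrivalentModel

/--
**Closure of the constraint algebra for `b`-deformed bipartite maps with vertices of degree at
most three.**
With `M⁽ᵐ⁾_i` determined by `M⁽¹⁾_i = (1+b)⁻¹·J_{i−1}` (`i ≥ 1`), `M⁽ᵐ⁾₀ = 0` (`m ≥ 1`), and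
the (locally finite) recursion `M⁽ᵐ⁺¹⁾_i = Σ_{n≥1} J_{i−n−1} ∘ M⁽ᵐ⁾_n + b(i−1)·M⁽ᵐ⁾_{i−1}`,
and `L_i := −p_i^* + q₁tM⁽¹⁾_i + q₂t²M⁽²⁾_i + q₃t³M⁽³⁾_i` in `End_K(R)[t]`, one has for all
`i, j ≥ 1`:
`[L_i, L_j] = t · Σ_{l≥1} (q₂·t·D̃_{ij,l}(2) + q₃·t²·D̃_{ij,l}(3)) ∘ L_l`
(a locally finite sum, the sum ranging over `l ≥ 1` so that the convention `L_l = 0` for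
`l ≤ 0` is automatic); the identity in `End_K(R)[t]` is expressed by evaluating both sides on
every polynomial coefficient sequence `F` (i.e. on every element of `R[t]`).
In particular the constraint operators of the trivalent bipartite map model are closed under
commutation for every value of `b`.
-/
theorem stmt_14 {K : Type} [Field K] [CharZero K] (b u : K) (hb : (1 : K) + b ≠ 0)
    (q₁ q₂ q₃ : K)
    (Mv : ℕ → ℕ → Module.End K (Rp K))
    (hbase1 : ∀ i : ℕ, 1 ≤ i → Mv 1 i = ((1 : K) + b)⁻¹ • JopU K b u ((i : ℤ) - 1))
    (hbase0 : ∀ m : ℕ, 1 ≤ m → Mv m 0 = 0)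
    (hfin : ∀ (m i : ℕ) (f : Rp K),
      (Set.Ici 1 ∩ Function.support fun n : ℕ =>
        (JopU K b u ((i : ℤ) - (n : ℤ) - 1)) ((Mv m n) f)).Finite)
    (hrec : ∀ m : ℕ, 1 ≤ m → ∀ i : ℕ, 1 ≤ i → ∀ f : Rp K,
      (Mv (m + 1) i) f =
        (∑ᶠ n ∈ Set.Ici (1 : ℕ), (JopU K b u ((i : ℤ) - (n : ℤ) - 1)) ((Mv m n) f)) +
          (b * ((i : K) - 1)) • (Mv m (i - 1)) f) :
    ∀ i j : ℕ, 1 ≤ i → 1 ≤ j →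
      (∀ F : ℕ → Rp K, (Function.support F).Finite →
        ⁅Ltri K q₁ q₂ q₃ Mv i, Ltri K q₁ q₂ q₃ Mv j⁆ F =
          tshift K (∑ᶠ l ∈ Set.Ici (1 : ℕ),
            (q₂ • (tshift K * liftE K (Dtcoef K b u i j l 2)) +
              q₃ • (tshift K ^ 2 * liftE K (Dtcoef K b u i j l 3)))
              ((Ltri K q₁ q₂ q₃ Mv l) F))) ∧
      (∀ F : ℕ → Rp K, (Function.support F).Finite →
        (Set.Ici 1 ∩ Function.support fun l : ℕ =>
          (q₂ • (tshift K * liftE K (Dtcoef K b u i j l 2)) +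
            q₃ • (tshift K ^ 2 * liftE K (Dtcoef K b u i j l 3)))
            ((Ltri K q₁ q₂ q₃ Mv l) F)).Finite) := by
  have H := isCurrentTower_JopU b u hb Mv hbase1 hbase0 hfin hrec
  refine fun i j hi hj => ⟨fun F hF => ?_, fun F hF => ?_⟩
  · obtain ⟨Y, hY, hsum⟩ := trivalent_closure b u q₁ q₂ q₃ H hi hj hF
    rw [hY, ← hsum.2, ← finsum_mem_def]
    rfl
  · obtain ⟨Y, -, hsum⟩ := trivalent_closure b u q₁ q₂ q₃ H hi hj hF
    have h := hsum.1
    rw [Set.support_indicator] at h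
    exact h
end
end

section
/- Virasoro closure of the constraint algebra for b-deformed bipartite maps: let u₁, u₂ ∈ K and, in the ring End_K(R)[t] of polynomials in a central variable t with operator coefficients, define for i ≥ 1 the operator L_i := −p_i^* + t·( A_i(2) + e₁(u₁,u₂)·A_i(1) + e₂(u₁,u₂)·A_i(0) ), where e₁(u₁,u₂) = u₁ + u₂ and e₂(u₁,u₂) = u₁u₂. Then for all i, j ≥ 1: [L_i, L_j] = t·(i−j)·L_{i+j−1}. In particular the constraint operators of the b-deformed bipartite map (2-constellation) model form a shifted half-Virasoro algebra for every value of b. -/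
noncomputable section

/-- The constraint operator `L_i = −p_i^* + t·(A_i(2) + e₁(u₁,u₂)·A_i(1) + e₂(u₁,u₂)·A_i(0))`
of the `b`-deformed bipartite map (`2`-constellation) model, an element of `End_K(R)[t]`
realized faithfully by its action on coefficient sequences, `t` acting as the shift `tshift`. -/
def Lbip (K : Type) [Field K] (u₁ u₂ : K) (A : ℕ → ℕ → Module.End K (Rp K)) (i : ℕ) :
    Module.End K (ℕ → Rp K) :=
  liftE K (-pstar K i) +
    tshift K * liftE K (A i 2 + (u₁ + u₂) • A i 1 + (u₁ * u₂) • A i 0)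

section Currents

open Finset

attribute [local instance] LieRing.ofAssociativeRing

variable {K 𝔸 : Type*} [Field K] [Ring 𝔸] [Algebra K 𝔸]

lemma lie_smul_of_algebra (r : K) (x y : 𝔸) : ⁅x, r • y⁆ = r • ⁅x, y⁆ := by
  rw [Ring.lie_def, Ring.lie_def, mul_smul_comm, smul_mul_assoc, smul_sub]

lemma smul_lie_of_algebra (r : K) (x y : 𝔸) : ⁅r • x, y⁆ = r • ⁅x, y⁆ := by
  rw [Ring.lie_def, Ring.lie_def, mul_smul_comm, smul_mul_assoc, smul_sub]

/-- The quadratic element `Σ_{k + l = m} P_k P_l`. -/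
def quadSum (P : ℕ → 𝔸) (m : ℕ) : 𝔸 :=
  ∑ k ∈ range (m + 1), P k * P (m - k)

/-- The closed form `E_m + (1+b) Σ_{k + l = m} P_k P_l + (b m + e) P_m + δ_{m,0} c` of the
coefficient of `t` in the constraint operator `L_{m+1}`. -/
def constraintCoeff (P E : ℕ → 𝔸) (b e c : K) (m : ℕ) : 𝔸 :=
  E m + (1 + b) • quadSum P m + (b * m + e) • P m + (if m = 0 then c else 0) • (1 : 𝔸)

variable {P E : ℕ → 𝔸}

lemma commute_quadSum (hPP : ∀ i j, Commute (P i) (P j))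
    (i m : ℕ) : Commute (P i) (quadSum P m) :=
  Commute.sum_right _ _ _ fun _ _ => (hPP _ _).mul_right (hPP _ _)

lemma quadSum_commute_quadSum (hPP : ∀ i j, Commute (P i) (P j))
    (m n : ℕ) : Commute (quadSum P m) (quadSum P n) :=
  Commute.sum_left _ _ _ fun _ _ =>
    (commute_quadSum hPP _ _).mul_left (commute_quadSum hPP _ _)

lemma smul_quadSum_add (hPP : ∀ i j, Commute (P i) (P j))
    (m n : ℕ) :
    ((m : K) - n) • quadSum P (m + n) =
      ∑ l ∈ range (m + n + 1), (2 * (l - n : K)) • (P l * P (m + n - l)) := by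
  have h : ∑ l ∈ range (m + n + 1), ((l : K) - n) • (P l * P (m + n - l)) =
      ∑ l ∈ range (m + n + 1), ((m : K) - l) • (P l * P (m + n - l)) := by
    rw [← sum_range_reflect]
    refine sum_congr rfl fun l hl => ?_
    have hl : l ≤ m + n := by simpa [Nat.lt_succ_iff] using hl
    rw [(by omega : m + n + 1 - 1 - l = m + n - l), (by omega : m + n - (m + n - l) = l),
      (hPP _ _).eq, Nat.cast_sub hl]
    push_cast
    congr 1
    ring
  simp only [two_mul, add_smul, sum_add_distrib]
  nth_rewrite 1 [h]
  rw [← sum_add_distrib, quadSum, smul_sum]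
  refine sum_congr rfl fun l _ => ?_
  rw [← add_smul]
  congr 1
  ring

lemma lie_quadSum (hPP : ∀ i j, Commute (P i) (P j))
    (hPE : ∀ i m, ⁅P i, E m⁆ = (i : K) • P (i + m))
    (m n : ℕ) :
    ⁅quadSum P m, E n⁆ = ∑ k ∈ range (m + 1), (2 * k : K) • (P (k + n) * P (m - k)) := by
  have h1 : ⁅quadSum P m, E n⁆ =
      ∑ k ∈ range (m + 1), (k : K) • (P (k + n) * P (m - k)) +
      ∑ k ∈ range (m + 1), ((m - k : ℕ) : K) • (P k * P (m - k + n)) := by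
    rw [quadSum, sum_lie, ← sum_add_distrib]
    refine sum_congr rfl fun k _ => ?_
    rw [← smul_mul_assoc, ← mul_smul_comm, ← hPE, ← hPE]
    simp only [Ring.lie_def]
    noncomm_ring
  have h2 : ∑ k ∈ range (m + 1), ((m - k : ℕ) : K) • (P k * P (m - k + n)) =
      ∑ k ∈ range (m + 1), (k : K) • (P (k + n) * P (m - k)) := by
    rw [← sum_range_reflect]
    refine sum_congr rfl fun k hk => ?_
    have hk : k ≤ m := by simpa [Nat.lt_succ_iff] using hk
    rw [(by omega : m + 1 - 1 - k = m - k), (by omega : m - (m - k) = k), (hPP _ _).eq]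
  rw [h1, h2, ← sum_add_distrib]
  refine sum_congr rfl fun k _ => ?_
  rw [← add_smul, two_mul]

lemma lie_quadSum_sub (hPP : ∀ i j, Commute (P i) (P j))
    (hPE : ∀ i m, ⁅P i, E m⁆ = (i : K) • P (i + m))
    (m n : ℕ) :
    ⁅quadSum P m, E n⁆ - ⁅quadSum P n, E m⁆ = ((m : K) - n) • quadSum P (m + n) := by
  have h1 : ∑ k ∈ range (m + 1), (2 * k : K) • (P (k + n) * P (m - k)) =
      ∑ l ∈ range (m + n + 1),
        if n ≤ l then (2 * (l - n : K)) • (P l * P (m + n - l)) else 0 := by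
    rw [(by omega : m + n + 1 = n + (m + 1)), sum_range_add _ n (m + 1),
      sum_eq_zero (s := range n), zero_add]
    · refine sum_congr rfl fun k _ => ?_
      rw [if_pos (by omega), (by omega : m + n - (n + k) = m - k), add_comm k n]
      push_cast
      congr 1
      ring
    · exact fun l hl => if_neg (by simpa using hl)
  have h2 : ∑ k ∈ range (n + 1), (2 * k : K) • (P (k + m) * P (n - k)) =
      ∑ l ∈ range (m + n + 1),
        if l ≤ n then (2 * (n - l : K)) • (P l * P (m + n - l)) else 0 := by
    rw [(by omega : m + n + 1 = (n + 1) + m), sum_range_add _ (n + 1) m,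
      sum_eq_zero (s := range m), add_zero,
      ← sum_range_reflect]
    · refine sum_congr rfl fun k hk => ?_
      have hk : k ≤ n := by simpa [Nat.lt_succ_iff] using hk
      rw [if_pos hk, (by omega : n + 1 - 1 - k = n - k), (by omega : n - (n - k) = k),
        (by omega : n - k + m = m + n - k), (hPP _ _).eq, Nat.cast_sub hk]
    · exact fun l _ => if_neg (by omega)
  rw [lie_quadSum hPP hPE, lie_quadSum hPP hPE, h1, h2, smul_quadSum_add hPP, ← sum_sub_distrib]
  refine sum_congr rfl fun l _ => ?_
  rcases lt_trichotomy l n with h | rfl | h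
  · rw [if_neg (by omega), if_pos h.le, zero_sub, ← neg_smul]
    congr 1
    ring
  · simp
  · rw [if_pos h.le, if_neg (by omega), sub_zero]

lemma lie_constraintCoeff (hPP : ∀ i j, Commute (P i) (P j))
    (hPE : ∀ i m, ⁅P i, E m⁆ = (i : K) • P (i + m))
    (b e c : K) (i n : ℕ) :
    ⁅P i, constraintCoeff P E b e c n⁆ = (i : K) • P (i + n) := by
  have h1 : ⁅P i, (1 : 𝔸)⁆ = 0 := (Commute.one_right _).lie_eq
  simp only [constraintCoeff, lie_add, lie_smul_of_algebra, hPE, (commute_quadSum hPP i n).lie_eq,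
    (hPP i n).lie_eq, h1, smul_zero, add_zero]

lemma neg_lie_constraintCoeff_add (hPP : ∀ i j, Commute (P i) (P j))
    (hPE : ∀ i m, ⁅P i, E m⁆ = (i : K) • P (i + m))
    (b e c : K) (m n : ℕ) :
    ⁅-P (m + 1), constraintCoeff P E b e c n⁆ + ⁅constraintCoeff P E b e c m, -P (n + 1)⁆ =
      ((m : K) - n) • -P (m + n + 1) := by
  rw [lie_neg, neg_lie, lie_skew (P (n + 1)), lie_constraintCoeff hPP hPE,
    lie_constraintCoeff hPP hPE, (by omega : n + 1 + m = m + n + 1),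
    (by omega : m + 1 + n = m + n + 1)]
  push_cast
  module

lemma neg_lie_neg_eq_zero (hPP : ∀ i j, Commute (P i) (P j)) (i j : ℕ) :
    ⁅-P i, -P j⁆ = 0 := by
  rw [neg_lie, lie_neg, neg_neg, (hPP i j).lie_eq]

lemma constraintCoeff_lie_constraintCoeff (hPP : ∀ i j, Commute (P i) (P j))
    (hPE : ∀ i m, ⁅P i, E m⁆ = (i : K) • P (i + m))
    (hEE : ∀ m n, ⁅E m, E n⁆ = ((m : K) - n) • E (m + n))
    (b e c : K) (m n : ℕ) :
    ⁅constraintCoeff P E b e c m, constraintCoeff P E b e c n⁆ =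
      ((m : K) - n) • constraintCoeff P E b e c (m + n) := by
  have hQ : ⁅quadSum P m, quadSum P n⁆ = 0 := (quadSum_commute_quadSum hPP m n).lie_eq
  have hQP : ⁅quadSum P m, P n⁆ = 0 := (commute_quadSum hPP n m).symm.lie_eq
  have hl (x : 𝔸) : ⁅(1 : 𝔸), x⁆ = 0 := (Commute.one_left _).lie_eq
  have hr (x : 𝔸) : ⁅x, (1 : 𝔸)⁆ = 0 := (Commute.one_right _).lie_eq
  have hEQ : ⁅E m, quadSum P n⁆ =
      ((m : K) - n) • quadSum P (m + n) - ⁅quadSum P m, E n⁆ := by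
    rw [← lie_quadSum_sub hPP hPE, ← lie_skew]
    abel
  have hEP : ⁅E m, P n⁆ = -((n : K) • P (m + n)) := by
    rw [← lie_skew, hPE, add_comm n m]
  have h0 : ((m : K) - n) * (if m + n = 0 then c else 0) = 0 := by
    split_ifs with h
    · obtain ⟨rfl, rfl⟩ : m = 0 ∧ n = 0 := by omega
      simp
    · simp
  simp only [constraintCoeff, add_lie, smul_lie_of_algebra, hl, lie_add, lie_smul_of_algebra,
     hEQ, hEP, hQ, hQP, hr,
    hEE, hPE, (hPP m n).lie_eq, (commute_quadSum hPP m n).lie_eq]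
  simp only [smul_add, smul_smul, h0]
  push_cast
  module

end Currents

section Virasoro

open MvPolynomial Finset

variable (K : Type) [Field K]

/-- The variable `p_k`, extended by `p₀ = 0`. -/
def varN (k : ℕ) : Rp K := if h : 0 < k then X (⟨k, h⟩ : ℕ+) else 0

/-- The derivation `p_m^* = m·∂/∂p_m`. -/
def pstarDer (m : ℕ) : Derivation K (Rp K) (Rp K) :=
  mkDerivation K fun k : ℕ+ => if (k : ℕ) = m then C (m : K) else 0

/-- The derivation `Σ_{k ≥ 1} p_k·p_{k+m}^*`, which maps `p_k` to `k·p_{k-m}`. -/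
def eulerDer (m : ℕ) : Derivation K (Rp K) (Rp K) :=
  mkDerivation K fun k : ℕ+ => ((k : ℕ) : K) • varN K (k - m)

variable {K}

lemma varN_zero : varN K 0 = 0 := by simp [varN]

lemma varN_coe (k : ℕ+) : varN K k = X k := by
  rw [varN, dif_pos k.pos]; rfl

lemma mulpN_apply (k : ℕ) (f : Rp K) : mulpN K k f = varN K k * f := by
  unfold mulpN varN
  split_ifs <;> simp

lemma pstarDer_varN (m k : ℕ) :
    pstarDer K m (varN K k) = if k = m then C (m : K) else 0 := by
  rcases Nat.eq_zero_or_pos k with rfl | hk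
  · rw [varN_zero, map_zero]
    split_ifs with h
    · subst h; simp
    · rfl
  · lift k to ℕ+ using hk
    rw [varN_coe, pstarDer, mkDerivation_X]

lemma eulerDer_varN (m k : ℕ) :
    eulerDer K m (varN K k) = (k : K) • varN K (k - m) := by
  rcases Nat.eq_zero_or_pos k with rfl | hk
  · simp [varN_zero]
  · lift k to ℕ+ using hk
    rw [varN_coe, eulerDer, mkDerivation_X]

lemma coe_pstarDer (m : ℕ) : (pstarDer K m : Module.End K (Rp K)) = pstar K m := by
  rcases Nat.eq_zero_or_pos m with rfl | hm
  · have : pstarDer K 0 = 0 := derivation_ext fun k => by simp [pstarDer]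
    simp [this, pstar]
  · lift m to ℕ+ using hm
    have hd : pderivN K m = (pderiv (R := K) m).toLinearMap := dif_pos m.pos
    rw [pstar, hd]
    refine congrArg Derivation.toLinearMap
      (?_ : pstarDer K m = ((m : ℕ) : K) • pderiv (R := K) m)
    refine derivation_ext fun k => ?_
    change _ = ((m : ℕ) : K) • pderiv (R := K) m (X k)
    rw [pstarDer, mkDerivation_X]
    by_cases h : k = m
    · rw [if_pos (by rw [h]), h, pderiv_X_self, smul_eq_C_mul, mul_one]
    · rw [if_neg (fun e => h (PNat.eq e)), pderiv_X_of_ne h, smul_zero]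

lemma pstarDer_apply (m : ℕ) (f : Rp K) : pstarDer K m f = pstar K m f := by
  rw [← coe_pstarDer]; rfl

lemma Jop_of_nat (b : K) (m : ℕ) : Jop K b m = (1 + b) • pstar K m := by
  rcases Nat.eq_zero_or_pos m with rfl | hm
  · simp [Jop, pstar, mulpN]
  · simp [Jop, pstar, hm, mul_smul]

lemma Jop_neg_nat (b : K) (m : ℕ) : Jop K b (-(m : ℤ)) = mulpN K m := by
  simp [Jop]

lemma lie_pstar_pstar (i j : ℕ) : ⁅pstar K i, pstar K j⁆ = 0 := by
  have h : ⁅pstarDer K i, pstarDer K j⁆ = 0 := derivation_ext fun k => by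
    rw [Derivation.commutator_apply, ← varN_coe, pstarDer_varN, pstarDer_varN]
    split_ifs <;> simp
  rw [← coe_pstarDer, ← coe_pstarDer, ← Derivation.commutator_coe_linear_map, h]
  rfl

lemma commute_pstar (i j : ℕ) : Commute (pstar K i) (pstar K j) :=
  sub_eq_zero.mp (lie_pstar_pstar i j)

lemma lie_pstar_eulerDer (i m : ℕ) :
    ⁅pstar K i, (eulerDer K m : Module.End K (Rp K))⁆ = (i : K) • pstar K (i + m) := by
  have h : ⁅pstarDer K i, eulerDer K m⁆ = (i : K) • pstarDer K (i + m) :=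
    derivation_ext fun k => by
      rw [Derivation.commutator_apply, Derivation.smul_apply, ← varN_coe, pstarDer_varN,
        eulerDer_varN, pstarDer_varN, Derivation.map_smul, pstarDer_varN]
      have hk := k.pos
      rcases Nat.eq_zero_or_pos i with rfl | hi
      · split_ifs <;> simp
      · by_cases h : (k : ℕ) = i + m
        · have h' : (k : ℕ) - m = i := by omega
          rw [if_pos h, if_pos h', h]
          split_ifs <;> simp [smul_eq_C_mul, mul_comm, mul_add]
        · have h' : (k : ℕ) - m ≠ i := by omega
          rw [if_neg h, if_neg h']
          split_ifs <;> simp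
  rw [← coe_pstarDer, ← coe_pstarDer, ← Derivation.commutator_coe_linear_map, h]
  rfl

lemma lie_eulerDer_eulerDer (m n : ℕ) :
    ⁅(eulerDer K m : Module.End K (Rp K)), (eulerDer K n : Module.End K (Rp K))⁆ =
      ((m : K) - n) • (eulerDer K (m + n) : Module.End K (Rp K)) := by
  have h : ⁅eulerDer K m, eulerDer K n⁆ = ((m : K) - n) • eulerDer K (m + n) :=
    derivation_ext fun k => by
      rw [Derivation.commutator_apply, Derivation.smul_apply, ← varN_coe]
      simp only [eulerDer_varN, Derivation.map_smul, smul_smul, Nat.sub_sub]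
      rw [add_comm n m]
      by_cases h : (k : ℕ) ≤ m + n
      · simp [Nat.sub_eq_zero_of_le h, varN_zero]
      · rw [Nat.cast_sub (by omega), Nat.cast_sub (by omega), ← sub_smul]
        congr 1
        ring
  rw [← Derivation.commutator_coe_linear_map, h]
  rfl

lemma lie_lift_add_shift_mul_lift (P M P' M' : Module.End K (Rp K)) :
    ⁅liftE K P + tshift K * liftE K M, liftE K P' + tshift K * liftE K M'⁆ =
      liftE K ⁅P, P'⁆ + tshift K * (liftE K (⁅P, M'⁆ + ⁅M, P'⁆) +
        tshift K * liftE K ⁅M, M'⁆) := by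
  refine LinearMap.ext fun F => funext fun n => ?_
  rcases n with _ | _ | n <;> simp [Ring.lie_def, liftE, tshift]
  · abel
  · abel

lemma sum_varN_mul_pstar (m N : ℕ) (f : Rp K) (hN : ∀ k ∈ f.vars, (k : ℕ) ≤ N) :
    ∑ k ∈ range (N + 1), varN K k * pstar K (k + m) f = eulerDer K m f := by
  have h : (∑ k ∈ range (N + 1), varN K k • pstarDer K (k + m)) f = eulerDer K m f := by
    refine derivation_eq_of_forall_mem_vars fun i hi => ?_
    have hi := hN i hi
    have hs (j : ℕ) : (varN K j • pstarDer K (j + m)) (varN K i) =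
        if (i : ℕ) = j + m then ((i : ℕ) : K) • varN K j else 0 := by
      change varN K j * pstarDer K (j + m) (varN K i) = _
      rw [pstarDer_varN]
      split_ifs with h
      · rw [h, smul_eq_C_mul, mul_comm]
      · rw [mul_zero]
    rw [← varN_coe, eulerDer_varN, ← Derivation.coeFnAddMonoidHom_apply, map_sum, Finset.sum_apply]
    simp only [Derivation.coeFnAddMonoidHom_apply, hs]
    by_cases him : m ≤ i
    · rw [sum_eq_single_of_mem ((i : ℕ) - m) (by simp; omega), if_pos (by omega)]
      exact fun j _ hj => if_neg (by omega)
    · rw [Nat.sub_eq_zero_of_le (by omega), varN_zero, smul_zero]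
      exact sum_eq_zero fun j _ => if_neg (by omega)
  rw [← h, ← Derivation.coeFnAddMonoidHom_apply, map_sum, Finset.sum_apply]
  refine sum_congr rfl fun k _ => ?_
  rw [← pstarDer_apply]
  rfl

lemma pstar_apply_eq_zero {N k : ℕ} {f : Rp K} (hN : ∀ k ∈ f.vars, (k : ℕ) ≤ N)
    (hk : N < k) : pstar K k f = 0 := by
  rw [← pstarDer_apply]
  refine derivation_eq_zero_of_forall_mem_vars fun i hi => ?_
  have hi := hN i hi
  rw [pstarDer, mkDerivation_X, if_neg (by omega)]

lemma finsum_Jop_pstar (b : K) (m : ℕ) (f : Rp K) :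
    ∑ᶠ n ∈ Set.Ici (1 : ℕ), Jop K b (((m + 1 : ℕ) : ℤ) - (n : ℤ)) (pstar K (n - 1) f) =
      eulerDer K m f + (1 + b) • quadSum (pstar K) m f := by
  obtain ⟨N, hN⟩ : ∃ N, ∀ k ∈ f.vars, (k : ℕ) ≤ N :=
    ⟨f.vars.sup (fun k => (k : ℕ)), fun k hk => le_sup (f := fun k : ℕ+ => (k : ℕ)) hk⟩
  have hsum : ∑ᶠ n ∈ Set.Ici (1 : ℕ), Jop K b (((m + 1 : ℕ) : ℤ) - (n : ℤ)) (pstar K (n - 1) f) =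
      ∑ n ∈ (range (m + 1 + N)).image Nat.succ,
        Jop K b (((m + 1 : ℕ) : ℤ) - (n : ℤ)) (pstar K (n - 1) f) := by
    refine finsum_mem_eq_sum_of_subset _ ?_ ?_
    · rintro n ⟨hn, hs⟩
      have hn : 1 ≤ n := hn
      have : n - 1 ≤ N := by
        by_contra h
        exact hs (by simp only [pstar_apply_eq_zero hN (not_le.mp h), map_zero])
      simp only [coe_image, Set.mem_image, mem_coe, mem_range]
      exact ⟨n - 1, by omega, Nat.succ_pred_eq_of_pos hn⟩
    · intro n hn
      simp only [coe_image, Set.mem_image] at hn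
      obtain ⟨k, -, rfl⟩ := hn
      exact Nat.le_add_left 1 k
  rw [hsum, sum_image (fun _ _ _ _ h => Nat.succ_injective h), sum_range_add, add_comm]
  congr 1
  · rw [← sum_varN_mul_pstar m N f hN, sum_range_succ', varN_zero, zero_mul, add_zero]
    refine sum_congr rfl fun k _ => ?_
    rw [(by push_cast; ring : ((m + 1 : ℕ) : ℤ) - ((m + 1 + k + 1 : ℕ) : ℤ) = -((k + 1 : ℕ) : ℤ)),
      Jop_neg_nat, mulpN_apply, (by omega : m + 1 + k + 1 - 1 = k + 1 + m)]
  · rw [quadSum, LinearMap.sum_apply, smul_sum]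
    refine sum_congr rfl fun k hk => ?_
    have hk : k ≤ m := by simpa [Nat.lt_succ_iff] using hk
    rw [(by push_cast [hk]; ring : ((m + 1 : ℕ) : ℤ) - ((k + 1 : ℕ) : ℤ) = ((m - k : ℕ) : ℤ)),
      Jop_of_nat, (commute_pstar k (m - k)).eq]
    rfl

variable {b : K} {A : ℕ → ℕ → Module.End K (Rp K)}

lemma level_one_eq_pstar
    (hb : (1 : K) + b ≠ 0)
    (hbase1 : A 1 0 = ((1 : K) + b)⁻¹ • (1 : Module.End K (Rp K)))
    (hbase : ∀ i : ℕ, i ≠ 1 → A i 0 = 0)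
    (hrec : ∀ i : ℕ, 1 ≤ i → ∀ (s : ℕ) (f : Rp K),
      (A i (s + 1)) f =
        (∑ᶠ n ∈ Set.Ici (1 : ℕ), (Jop K b ((i : ℤ) - (n : ℤ))) ((A n s) f)) +
          (b * ((i : K) - 1)) • (A i s) f)
    (m : ℕ) : A (m + 1) 1 = pstar K m := by
  refine LinearMap.ext fun f => ?_
  have h0 : (b * (((m + 1 : ℕ) : K) - 1)) • (A (m + 1) 0) f = 0 := by
    rcases Nat.eq_zero_or_pos m with rfl | hm
    · simp
    · rw [hbase _ (by omega), LinearMap.zero_apply, smul_zero]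
  have h1 : ∑ᶠ n ∈ Set.Ici (1 : ℕ), (Jop K b (((m + 1 : ℕ) : ℤ) - (n : ℤ))) ((A n 0) f) =
      ∑ n ∈ ({1} : Finset ℕ), (Jop K b (((m + 1 : ℕ) : ℤ) - (n : ℤ))) ((A n 0) f) := by
    refine finsum_mem_eq_sum_of_subset _ ?_ (by simp)
    rintro n ⟨-, hn⟩
    by_contra h
    refine hn ?_
    simp only [hbase n (by simpa using h), LinearMap.zero_apply, map_zero]
  rw [hrec _ (by omega), h0, h1, add_zero, sum_singleton,
    (by push_cast; ring : ((m + 1 : ℕ) : ℤ) - ((1 : ℕ) : ℤ) = (m : ℤ)), Jop_of_nat, hbase1,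
    LinearMap.smul_apply, LinearMap.smul_apply, Module.End.one_apply, map_smul, smul_smul,
    mul_inv_cancel₀ hb, one_smul]

lemma level_sum_eq_constraintCoeff
    (hb : (1 : K) + b ≠ 0)
    (hbase1 : A 1 0 = ((1 : K) + b)⁻¹ • (1 : Module.End K (Rp K)))
    (hbase : ∀ i : ℕ, i ≠ 1 → A i 0 = 0)
    (hrec : ∀ i : ℕ, 1 ≤ i → ∀ (s : ℕ) (f : Rp K),
      (A i (s + 1)) f =
        (∑ᶠ n ∈ Set.Ici (1 : ℕ), (Jop K b ((i : ℤ) - (n : ℤ))) ((A n s) f)) +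
          (b * ((i : K) - 1)) • (A i s) f)
    (e₁ e₂ : K) (m : ℕ) :
    A (m + 1) 2 + e₁ • A (m + 1) 1 + e₂ • A (m + 1) 0 =
      constraintCoeff (pstar K) (fun k => (eulerDer K k : Module.End K (Rp K))) b e₁
        (e₂ * (1 + b)⁻¹) m := by
  have h1 := level_one_eq_pstar hb hbase1 hbase hrec
  have h2 : A (m + 1) 2 = (eulerDer K m : Module.End K (Rp K)) +
      (1 + b) • quadSum (pstar K) m + (b * m) • pstar K m := by
    refine LinearMap.ext fun f => ?_
    have hc : ∑ᶠ n ∈ Set.Ici (1 : ℕ), Jop K b (((m + 1 : ℕ) : ℤ) - (n : ℤ)) (A n 1 f) =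
        ∑ᶠ n ∈ Set.Ici (1 : ℕ),
          Jop K b (((m + 1 : ℕ) : ℤ) - (n : ℤ)) (pstar K (n - 1) f) := by
      refine finsum_mem_congr rfl fun n hn => ?_
      obtain ⟨k, rfl⟩ : ∃ k, n = k + 1 := ⟨n - 1, (Nat.succ_pred_eq_of_pos hn).symm⟩
      rw [h1, Nat.add_sub_cancel]
    rw [hrec _ (by omega), hc, finsum_Jop_pstar, h1, Nat.cast_succ, add_sub_cancel_right]
    rfl
  have h0 : e₂ • A (m + 1) 0 =
      (if m = 0 then e₂ * (1 + b)⁻¹ else 0) • (1 : Module.End K (Rp K)) := by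
    split_ifs with h
    · rw [h, hbase1, smul_smul]
    · rw [hbase _ (by omega), smul_zero, zero_smul]
  rw [constraintCoeff, h2, h1, h0, add_smul (b * m : K), ← add_assoc]

end Virasoro

/--
**Virasoro closure of the constraint algebra for `b`-deformed bipartite maps.**
With `A_i(s)` determined by `A₁(0) = (1+b)⁻¹·id`, `A_i(0) = 0` for `i ≠ 1` and the
(locally finite) recursion `A_i(s+1) = Σ_{n≥1} J_{i−n} ∘ A_n(s) + b(i−1)·A_i(s)`, and
`L_i := −p_i^* + t·(A_i(2) + e₁(u₁,u₂)·A_i(1) + e₂(u₁,u₂)·A_i(0))` in `End_K(R)[t]`,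
one has `[L_i, L_j] = t·(i−j)·L_{i+j−1}` for all `i, j ≥ 1`: the constraint operators of the
`b`-deformed bipartite map model form a shifted half-Virasoro algebra for every value of `b`.
-/
theorem stmt_15 {K : Type} [Field K] [CharZero K] (b : K) (hb : (1 : K) + b ≠ 0)
    (u₁ u₂ : K)
    (A : ℕ → ℕ → Module.End K (Rp K))
    (hbase1 : A 1 0 = ((1 : K) + b)⁻¹ • (1 : Module.End K (Rp K)))
    (hbase : ∀ i : ℕ, i ≠ 1 → A i 0 = 0)
    (hfin : ∀ (i s : ℕ) (f : Rp K),
      (Set.Ici 1 ∩ Function.support fun n : ℕ =>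
        (Jop K b ((i : ℤ) - (n : ℤ))) ((A n s) f)).Finite)
    (hrec : ∀ i : ℕ, 1 ≤ i → ∀ (s : ℕ) (f : Rp K),
      (A i (s + 1)) f =
        (∑ᶠ n ∈ Set.Ici (1 : ℕ), (Jop K b ((i : ℤ) - (n : ℤ))) ((A n s) f)) +
          (b * ((i : K) - 1)) • (A i s) f) :
    ∀ i j : ℕ, 1 ≤ i → 1 ≤ j →
      ⁅Lbip K u₁ u₂ A i, Lbip K u₁ u₂ A j⁆ =
        ((i : K) - (j : K)) • (tshift K * Lbip K u₁ u₂ A (i + j - 1)) := by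
  intro i j hi hj
  obtain ⟨m, rfl⟩ : ∃ m, i = m + 1 := ⟨i - 1, by omega⟩
  obtain ⟨n, rfl⟩ : ∃ n, j = n + 1 := ⟨j - 1, by omega⟩
  set M := constraintCoeff (pstar K) (fun k => (eulerDer K k : Module.End K (Rp K))) b (u₁ + u₂)
    (u₁ * u₂ * (1 + b)⁻¹)
  have hM (k : ℕ) : A (k + 1) 2 + (u₁ + u₂) • A (k + 1) 1 + (u₁ * u₂) • A (k + 1) 0 = M k :=
    level_sum_eq_constraintCoeff hb hbase1 hbase hrec _ _ k
  have hMM : ⁅M m, M n⁆ = ((m : K) - n) • M (m + n) :=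
    constraintCoeff_lie_constraintCoeff commute_pstar lie_pstar_eulerDer lie_eulerDer_eulerDer
      _ _ _ m n
  have hPP : ⁅-pstar K (m + 1), -pstar K (n + 1)⁆ = 0 := neg_lie_neg_eq_zero commute_pstar _ _
  have hPM : ⁅-pstar K (m + 1), M n⁆ + ⁅M m, -pstar K (n + 1)⁆ =
      ((m : K) - n) • -pstar K (m + n + 1) :=
    neg_lie_constraintCoeff_add commute_pstar lie_pstar_eulerDer _ _ _ m n
  rw [(by omega : m + 1 + (n + 1) - 1 = m + n + 1)]
  simp only [Lbip, hM]
  rw [lie_lift_add_shift_mul_lift, hPP, hPM, hMM]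
  refine LinearMap.ext fun F => funext fun k => ?_
  rcases k with _ | _ | k <;> simp [liftE, tshift]
end
end
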